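/- Suppose n, d → ∞ with n/d² → α ∈ (0,∞). Then the pair (Ω_1^{(n)}, Ω_2^{(n)}) converges in distribution to (Ω^{(1)}, Ω^{(2)}), where Ω^{(1)} and Ω^{(2)} are independent copies of Ω = Φ(α^{−1/2} + Z), with Z standard normal. -/

import Mathlib

open MeasureTheory ProbabilityTheory Filter Topology Matrix

noncomputable section

/-- The law `N(0, I_d/d)` on `ℝ^d`. -/
def stdGaussianVec (d : ℕ) : Measure (Fin d → ℝ) :=
  Measure.pi fun _ => gaussianReal 0 (d : NNReal)⁻¹

/-- The Gaussian model: `u_1, …, u_n, v_1, …, v_n` mutually independent `N(0, I_d/d)`. -/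
def gaussianModel (d n : ℕ) :
    Measure ((Fin n → Fin d → ℝ) × (Fin n → Fin d → ℝ)) :=
  (Measure.pi fun _ : Fin n => stdGaussianVec d).prod
    (Measure.pi fun _ : Fin n => stdGaussianVec d)

/-- The correlation matrix memory `W^× = U Vᵀ`. -/
def Wcross {d n : ℕ} (u v : Fin n → Fin d → ℝ) : Matrix (Fin d) (Fin d) ℝ :=
  Matrix.of fun a b => ∑ i, u i a * v i b

/-- The score `s_{j,i} = u_j^⊤ W^× v_i` under the correlation matrix memory. -/
def scoreX {d n : ℕ} (u v : Fin n → Fin d → ℝ) (j i : Fin n) : ℝ :=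
  u j ⬝ᵥ (Wcross u v).mulVec (v i)

/-- The signal percentile `Ω_i^{(n)}`. -/
def percentile {d n : ℕ} (p : (Fin n → Fin d → ℝ) × (Fin n → Fin d → ℝ))
    (i : Fin n) : ℝ :=
  (∑ j ∈ Finset.univ.erase i,
      if scoreX p.1 p.2 j i ≤ scoreX p.1 p.2 i i then (1 : ℝ) else 0) / ((n : ℝ) - 1)

/-- The standard normal CDF `Φ`. -/
def Phi (x : ℝ) : ℝ := (gaussianReal 0 1 (Set.Iic x)).toReal

/-! ### Part 1: Gaussian vectors -/

instance stdGaussianVec_isProb (d : ℕ) : IsProbabilityMeasure (stdGaussianVec d) := by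
  unfold stdGaussianVec; infer_instance

instance gaussianModel_isProb (d n : ℕ) : IsProbabilityMeasure (gaussianModel d n) := by
  unfold gaussianModel; infer_instance

/-- All moments finite. -/
def AllLp {Ω : Type*} [MeasurableSpace Ω] (μ : Measure Ω) (f : Ω → ℝ) : Prop :=
  ∀ p : ENNReal, p ≠ ⊤ → MemLp f p μ

section AllLp
set_option linter.unusedSectionVars false
variable {Ω : Type*} [MeasurableSpace Ω] {μ : Measure Ω} [IsProbabilityMeasure μ]

lemma AllLp.mul {f g : Ω → ℝ} (hf : AllLp μ f) (hg : AllLp μ g) :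
    AllLp μ (fun x => f x * g x) := by
  intro p hp
  have h2 : (2 * p : ENNReal) ≠ ⊤ := ENNReal.mul_ne_top (by simp) hp
  have : ENNReal.HolderTriple (2 * p) (2 * p) p := by
    constructor
    rw [ENNReal.mul_inv (by simp) (by simp), ← add_mul, ENNReal.inv_two_add_inv_two, one_mul]
  exact MemLp.mul' (hg _ h2) (hf _ h2)

lemma AllLp.add {f g : Ω → ℝ} (hf : AllLp μ f) (hg : AllLp μ g) :
    AllLp μ (fun x => f x + g x) := fun p hp => (hf p hp).add (hg p hp)

lemma AllLp.sub {f g : Ω → ℝ} (hf : AllLp μ f) (hg : AllLp μ g) :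
    AllLp μ (fun x => f x - g x) := fun p hp => (hf p hp).sub (hg p hp)

lemma AllLp.const (c : ℝ) : AllLp μ (fun _ => c) := fun _ _ => memLp_const c

lemma AllLp.sum {ι : Type*} (s : Finset ι) {f : ι → Ω → ℝ} (hf : ∀ i, AllLp μ (f i)) :
    AllLp μ (fun x => ∑ i ∈ s, f i x) := fun p hp => memLp_finsetSum s fun i _ => hf i p hp

lemma AllLp.pow {f : Ω → ℝ} (hf : AllLp μ f) (k : ℕ) : AllLp μ (fun x => f x ^ k) := by
  induction k with
  | zero => simpa using AllLp.const 1
  | succ k ih => simpa [pow_succ] using ih.mul hf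

lemma AllLp.abs {f : Ω → ℝ} (hf : AllLp μ f) : AllLp μ (fun x => |f x|) :=
  fun p hp => (hf p hp).abs

lemma AllLp.integrable {f : Ω → ℝ} (hf : AllLp μ f) : Integrable f μ :=
  memLp_one_iff_integrable.1 (hf 1 (by simp))

lemma AllLp.comp {Ω' : Type*} [MeasurableSpace Ω'] {ν : Measure Ω'} {f : Ω → ℝ} {g : Ω' → Ω}
    (hf : AllLp μ f) (hg : MeasurePreserving g ν μ) : AllLp ν (fun x => f (g x)) :=
  fun p hp => (hf p hp).comp_measurePreserving hg

lemma sq_integral_abs_le {f : Ω → ℝ} (hf : AllLp μ f) :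
    (∫ x, |f x| ∂μ) ^ 2 ≤ ∫ x, f x ^ 2 ∂μ := by
  have h := variance_nonneg (fun x => |f x|) μ
  rw [variance_eq_sub (hf.abs 2 (by simp))] at h
  simp only [Pi.pow_apply, sq_abs] at h
  linarith

end AllLp

lemma gauss_allLp (v : NNReal) : AllLp (gaussianReal 0 v) (fun x => x) :=
  fun p hp => memLp_id_gaussianReal' p hp

lemma vec_allLp (d : ℕ) (p : Fin d) : AllLp (stdGaussianVec d) (fun u => u p) :=
  (gauss_allLp _).comp (measurePreserving_eval (fun _ : Fin d => gaussianReal 0 (d : NNReal)⁻¹) p)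

lemma lin_allLp (d : ℕ) (c : Fin d → ℝ) :
    AllLp (stdGaussianVec d) (fun u => ∑ p, c p * u p) :=
  AllLp.sum _ fun p => (AllLp.const _).mul (vec_allLp d p)

lemma vec_cf (d : ℕ) (c : Fin d → ℝ) :
    ∫ u, Complex.exp (((∑ p, c p * u p : ℝ) : ℂ) * Complex.I) ∂stdGaussianVec d
      = ((Real.exp (-(∑ p, c p ^ 2) / (2 * d)) : ℝ) : ℂ) := by
  have h1 : ∀ u : Fin d → ℝ, Complex.exp (((∑ p, c p * u p : ℝ) : ℂ) * Complex.I)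
      = ∏ p, Complex.exp ((c p : ℂ) * (u p : ℂ) * Complex.I) := by
    intro u
    rw [← Complex.exp_sum, ← Finset.sum_mul]
    push_cast; rfl
  simp_rw [h1]
  unfold stdGaussianVec
  rw [integral_fintype_prod_eq_prod (fun p (x : ℝ) => Complex.exp ((c p : ℂ) * (x : ℂ) * Complex.I))]
  simp_rw [← charFun_apply_real, charFun_gaussianReal]
  rw [← Complex.exp_sum, Complex.ofReal_exp]
  congr 1
  push_cast
  rw [neg_div, Finset.sum_div, ← Finset.sum_neg_distrib]
  refine Finset.sum_congr rfl fun p _ => ?_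
  simp
  ring_nf

lemma lin_map (d : ℕ) (c : Fin d → ℝ) :
    (stdGaussianVec d).map (fun u => ∑ p, c p * u p)
      = gaussianReal 0 (Real.toNNReal ((∑ p, c p ^ 2) / d)) := by
  have hm : Measurable (fun u : Fin d → ℝ => ∑ p, c p * u p) := by fun_prop
  have := Measure.isProbabilityMeasure_map (μ := stdGaussianVec d) hm.aemeasurable
  apply Measure.ext_of_charFun
  ext t
  rw [charFun_gaussianReal, charFun_apply_real, integral_map hm.aemeasurable (by fun_prop)]
  have h := vec_cf d (fun p => t * c p)
  have h2 : ∀ u : Fin d → ℝ, (((∑ p, t * c p * u p : ℝ) : ℂ)) = (t : ℂ) * ((∑ p, c p * u p : ℝ) : ℂ) := by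
    intro u; rw [← Complex.ofReal_mul, Finset.mul_sum]; simp [mul_assoc]
  simp_rw [h2] at h
  rw [h, Complex.ofReal_exp]
  congr 1
  have h0 : 0 ≤ (∑ p, c p ^ 2) / (d : ℝ) := by positivity
  have h3 : ((Real.toNNReal ((∑ p, c p ^ 2) / d) : NNReal) : ℂ) = (((∑ p, c p ^ 2) / d : ℝ) : ℂ) := by
    rw [← Real.coe_toNNReal _ h0]; simp
  rw [h3]
  push_cast
  simp_rw [mul_pow, ← Finset.mul_sum]
  ring

/-- fourth moment of the standard Gaussian -/
def C4 : ℝ := ∫ x, x ^ 4 ∂gaussianReal 0 1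

lemma C4_nonneg : 0 ≤ C4 := integral_nonneg fun x => by positivity

lemma gauss_scale (v : NNReal) :
    gaussianReal 0 v = (gaussianReal 0 1).map (fun x => Real.sqrt v * x) := by
  rw [gaussianReal_map_const_mul]
  congr 1
  · simp
  · ext; simp

lemma gauss_m2 (v : NNReal) : ∫ x, x ^ 2 ∂gaussianReal 0 v = v := by
  have := variance_fun_id_gaussianReal (μ := 0) (v := v)
  rw [variance_eq_sub ((gauss_allLp v) 2 (by simp))] at this
  simpa using this

lemma gauss_m4 (v : NNReal) : ∫ x, x ^ 4 ∂gaussianReal 0 v = C4 * (v : ℝ) ^ 2 := by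
  rw [gauss_scale, integral_map (by fun_prop) (by fun_prop)]
  simp_rw [mul_pow]
  rw [integral_const_mul, C4, mul_comm]
  congr 1
  rw [show (4 : ℕ) = 2 * 2 from rfl, pow_mul, Real.sq_sqrt (NNReal.coe_nonneg v)]

lemma lin_m2 (d : ℕ) (c : Fin d → ℝ) :
    ∫ u, (∑ p, c p * u p) ^ 2 ∂stdGaussianVec d = (∑ p, c p ^ 2) / d := by
  have h := gauss_m2 (Real.toNNReal ((∑ p, c p ^ 2) / d))
  have hm : Measurable (fun u : Fin d → ℝ => ∑ p, c p * u p) := by fun_prop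
  rw [← lin_map, integral_map hm.aemeasurable (by fun_prop), Real.coe_toNNReal _ (by positivity)] at h
  exact h

lemma lin_m4 (d : ℕ) (c : Fin d → ℝ) :
    ∫ u, (∑ p, c p * u p) ^ 4 ∂stdGaussianVec d = C4 * ((∑ p, c p ^ 2) / d) ^ 2 := by
  have h := gauss_m4 (Real.toNNReal ((∑ p, c p ^ 2) / d))
  have hm : Measurable (fun u : Fin d → ℝ => ∑ p, c p * u p) := by fun_prop
  rw [← lin_map, integral_map hm.aemeasurable (by fun_prop), Real.coe_toNNReal _ (by positivity)] at h
  exact h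

/-- dot-product second moment bounds -/
lemma coord_m2 (d : ℕ) (p : Fin d) : ∫ u, u p ^ 2 ∂stdGaussianVec d = 1 / d := by
  have := lin_m2 d (fun q => if q = p then 1 else 0)
  simpa using this

lemma norm_sq_dev (d : ℕ) (hd : 0 < d) :
    ∫ u, ((∑ p, u p * u p) - 1) ^ 2 ∂stdGaussianVec d ≤ C4 / d := by
  have hall : AllLp (stdGaussianVec d) (fun u => ∑ p, u p * u p) :=
    AllLp.sum _ fun p => (vec_allLp d p).mul (vec_allLp d p)
  have hmean : ∫ u, (∑ p, u p * u p) ∂stdGaussianVec d = 1 := by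
    rw [integral_finsetSum _ fun p _ => ((vec_allLp d p).mul (vec_allLp d p)).integrable]
    simp_rw [← pow_two, coord_m2]
    have : (d : ℝ) ≠ 0 := by positivity
    simp [this]
  have hv : Var[fun u => ∑ p, u p * u p; stdGaussianVec d]
      = ∑ p : Fin d, Var[fun x => x * x; gaussianReal 0 (d : NNReal)⁻¹] := by
    rw [← variance_sum_pi (μ := fun _ : Fin d => gaussianReal 0 (d : NNReal)⁻¹)
      (X := fun _ x => x * x)
      (fun i => ((gauss_allLp _).mul (gauss_allLp _)) 2 (by simp))]
    unfold stdGaussianVec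
    congr 1
    ext u; simp
  rw [variance_eq_integral (hall 2 (by simp)).aestronglyMeasurable.aemeasurable, hmean] at hv
  rw [hv]
  have h1 : Var[fun x => x * x; gaussianReal 0 (d : NNReal)⁻¹] ≤ C4 * ((d : ℝ)⁻¹) ^ 2 := by
    have := variance_le_expectation_sq (μ := gaussianReal 0 (d : NNReal)⁻¹) (X := fun x : ℝ => x * x)
      (by fun_prop)
    refine this.trans (le_of_eq ?_)
    have h4 := gauss_m4 (d : NNReal)⁻¹
    rw [show (((d : NNReal)⁻¹ : NNReal) : ℝ) = (d : ℝ)⁻¹ by simp] at h4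
    rw [← h4]
    congr 1; ext x; simp; ring
  calc _ ≤ ∑ p : Fin d, C4 * ((d : ℝ)⁻¹) ^ 2 := Finset.sum_le_sum fun _ _ => h1
    _ = C4 / d := by
      have : (d : ℝ) ≠ 0 := by positivity
      simp; field_simp

lemma dot_dev (d : ℕ) (hd : 0 < d) :
    ∫ z, (∑ p, z.1 p * z.2 p) ^ 2 ∂((stdGaussianVec d).prod (stdGaussianVec d)) = 1 / d := by
  have hall : AllLp ((stdGaussianVec d).prod (stdGaussianVec d))
      (fun z => (∑ p, z.1 p * z.2 p) ^ 2) :=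
    (AllLp.sum _ fun p => ((vec_allLp d p).comp measurePreserving_fst).mul
      ((vec_allLp d p).comp measurePreserving_snd)).pow 2
  rw [integral_prod _ hall.integrable]
  simp_rw [lin_m2, Finset.sum_div]
  rw [integral_finsetSum _ fun p _ => (((vec_allLp d p).pow 2).integrable).div_const _]
  simp_rw [integral_div, coord_m2]
  have : (d : ℝ) ≠ 0 := by positivity
  simp; field_simp

/-! ### Part 2: bilinear characteristic function -/

/-- squared Frobenius norm -/
def Fr {d : ℕ} (A : Fin d → Fin d → ℝ) : ℝ := ∑ b, ∑ a, A a b ^ 2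

lemma Fr_nonneg {d : ℕ} (A : Fin d → Fin d → ℝ) : 0 ≤ Fr A := by unfold Fr; positivity

/-- `|Aᵀ u|²` -/
def Yq {d : ℕ} (A : Fin d → Fin d → ℝ) (u : Fin d → ℝ) : ℝ := ∑ b, (∑ a, A a b * u a) ^ 2

lemma Yq_nonneg {d : ℕ} (A : Fin d → Fin d → ℝ) (u) : 0 ≤ Yq A u := by unfold Yq; positivity

lemma Yq_allLp {d : ℕ} (A : Fin d → Fin d → ℝ) : AllLp (stdGaussianVec d) (Yq A) :=
  AllLp.sum _ fun b => (lin_allLp d (fun a => A a b)).pow 2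

/-- characteristic function of `uᵀ A v` -/
def phiA {d : ℕ} (A : Fin d → Fin d → ℝ) : ℝ :=
  ∫ u, Real.exp (-(Yq A u) / (2 * d)) ∂stdGaussianVec d

lemma Yq_m1 {d : ℕ} (A : Fin d → Fin d → ℝ) : ∫ u, Yq A u ∂stdGaussianVec d = Fr A / d := by
  unfold Yq Fr
  rw [integral_finsetSum _ fun b _ => ((lin_allLp d (fun a => A a b)).pow 2).integrable]
  simp_rw [lin_m2, Finset.sum_div]

lemma Yq_m2 {d : ℕ} (A : Fin d → Fin d → ℝ) :
    ∫ u, Yq A u ^ 2 ∂stdGaussianVec d ≤ C4 * (Fr A / d) ^ 2 := by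
  set w : Fin d → ℝ := fun b => ∑ a, A a b ^ 2 with hw
  have hw0 : ∀ b, 0 ≤ w b := fun b => by simp only [hw]; positivity
  have hpt : ∀ u, Yq A u ^ 2 ≤ Fr A * ∑ b, (w b)⁻¹ * (∑ a, A a b * u a) ^ 4 := by
    intro u
    refine Finset.sum_sq_le_sum_mul_sum_of_sq_le_mul _ (fun b _ => hw0 b)
      (fun b _ => mul_nonneg (inv_nonneg.2 (hw0 b)) (by positivity)) fun b _ => ?_
    refine le_of_eq ?_
    by_cases h : w b = 0
    · have hz : ∀ a, A a b = 0 := by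
        intro a
        have := (Finset.sum_eq_zero_iff_of_nonneg (fun a _ => sq_nonneg (A a b))).1 h a (Finset.mem_univ _)
        simpa using this
      simp [hz]
    · change _ = w b * _
      rw [← mul_assoc, mul_inv_cancel₀ h]; ring
  have hI : ∀ b, Integrable (fun u : Fin d → ℝ => (w b)⁻¹ * (∑ a, A a b * u a) ^ 4) (stdGaussianVec d) :=
    fun b => ((lin_allLp d (fun a => A a b)).pow 4).integrable.const_mul _
  calc _ ≤ ∫ u, Fr A * ∑ b, (w b)⁻¹ * (∑ a, A a b * u a) ^ 4 ∂stdGaussianVec d :=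
        integral_mono ((Yq_allLp A).pow 2).integrable
          ((integrable_finsetSum _ fun b _ => hI b).const_mul _) hpt
    _ = Fr A * ∑ b, (w b)⁻¹ * (C4 * (w b / d) ^ 2) := by
        rw [integral_const_mul, integral_finsetSum _ fun b _ => hI b]
        simp_rw [integral_const_mul, lin_m4, hw]
    _ = Fr A * ∑ b, w b * (C4 / d ^ 2) := by
        congr 1
        refine Finset.sum_congr rfl fun b _ => ?_
        by_cases h : w b = 0
        · simp [h]
        · field_simp
    _ = C4 * (Fr A / d) ^ 2 := by
        rw [← Finset.sum_mul, show ∑ b, w b = Fr A from rfl]; ring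

lemma exp_taylor {y : ℝ} (hy : 0 ≤ y) : |Real.exp (-y) - (1 - y)| ≤ y ^ 2 / 2 := by
  have h1 := Real.add_one_le_exp (-y)
  have h2 : Real.exp (-y) ≤ 1 - y + y ^ 2 / 2 := by
    have h3 := Real.quadratic_le_exp_of_nonneg hy
    rw [Real.exp_neg]
    have h4 : (0 : ℝ) < 1 + y + y ^ 2 / 2 := by positivity
    refine (inv_anti₀ h4 h3).trans ?_
    rw [inv_le_iff_one_le_mul₀ h4]
    nlinarith [pow_nonneg hy 4]
  rw [abs_le]; constructor <;> linarith [sq_nonneg y]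

lemma phiA_int {d : ℕ} (A : Fin d → Fin d → ℝ) :
    Integrable (fun u => Real.exp (-(Yq A u) / (2 * d))) (stdGaussianVec d) := by
  refine Integrable.of_bound (C := 1) ?_ ?_
  · have : Measurable (Yq A) := by unfold Yq; fun_prop
    exact (by fun_prop : Measurable fun u => Real.exp (-(Yq A u) / (2 * d))).aestronglyMeasurable
  · refine ae_of_all _ fun u => ?_
    rw [Real.norm_eq_abs, Real.abs_exp, Real.exp_le_one_iff]
    have := Yq_nonneg A u
    rw [neg_div]; simp only [Left.neg_nonpos_iff]; positivity

lemma phiA_nonneg {d : ℕ} (A : Fin d → Fin d → ℝ) : 0 ≤ phiA A :=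
  integral_nonneg fun u => (Real.exp_pos _).le

lemma phiA_le_one {d : ℕ} (A : Fin d → Fin d → ℝ) : phiA A ≤ 1 := by
  have : phiA A ≤ ∫ (_ : Fin d → ℝ), (1 : ℝ) ∂stdGaussianVec d := by
    refine integral_mono (phiA_int A) (integrable_const _) ?_
    intro u
    simp only [Real.exp_le_one_iff]
    have := Yq_nonneg A u
    rw [neg_div]; simp only [Left.neg_nonpos_iff]; positivity
  simpa using this

lemma phiA_approx {d : ℕ} (A : Fin d → Fin d → ℝ) :
    |phiA A - (1 - Fr A / (2 * d ^ 2))| ≤ C4 * Fr A ^ 2 / (8 * d ^ 4) := by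
  have hY := (Yq_allLp A).integrable
  have h1 : phiA A - (1 - Fr A / (2 * d ^ 2)) =
      ∫ u, (Real.exp (-(Yq A u) / (2 * d)) - (1 - Yq A u / (2 * d))) ∂stdGaussianVec d := by
    have hZ : Integrable (fun u => 1 - Yq A u / (2 * d)) (stdGaussianVec d) :=
      (integrable_const _).sub (hY.div_const _)
    rw [integral_sub (phiA_int A) hZ,
      integral_sub (integrable_const _) (hY.div_const _), integral_div, Yq_m1]
    simp only [integral_const, probReal_univ, one_smul, phiA]
    congr 2
    rw [div_div]; ring
  rw [h1]
  calc _ ≤ ∫ u, |Real.exp (-(Yq A u) / (2 * d)) - (1 - Yq A u / (2 * d))| ∂stdGaussianVec d :=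
        abs_integral_le_integral_abs
    _ ≤ ∫ u, Yq A u ^ 2 * (1 / (8 * d ^ 2)) ∂stdGaussianVec d := by
        refine integral_mono ((phiA_int A).sub ((integrable_const _).sub (hY.div_const _))).abs
          (((Yq_allLp A).pow 2).integrable.mul_const _) fun u => ?_
        have h := exp_taylor (y := Yq A u / (2 * d)) (div_nonneg (Yq_nonneg A u) (by positivity))
        rw [← neg_div] at h
        refine h.trans (le_of_eq ?_)
        rw [div_pow]; ring
    _ = (∫ u, Yq A u ^ 2 ∂stdGaussianVec d) * (1 / (8 * d ^ 2)) := integral_mul_const _ _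
    _ ≤ C4 * (Fr A / d) ^ 2 * (1 / (8 * d ^ 2)) :=
        mul_le_mul_of_nonneg_right (Yq_m2 A) (by positivity)
    _ = _ := by rw [div_pow]; ring

lemma cf_bilin {d : ℕ} (A : Fin d → Fin d → ℝ) :
    ∫ z, Complex.exp (((∑ b, (∑ a, A a b * z.1 a) * z.2 b : ℝ) : ℂ) * Complex.I)
      ∂((stdGaussianVec d).prod (stdGaussianVec d)) = (phiA A : ℂ) := by
  rw [integral_prod]
  · simp_rw [vec_cf d]
    rw [integral_complex_ofReal]
    rfl
  · refine Integrable.of_bound (C := 1) (by fun_prop) (ae_of_all _ fun z => ?_)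
    rw [Complex.norm_exp_ofReal_mul_I]

/-! ### Part 3: moments of Gram entries -/

/-- Gram entries -/
def Dg {d r : ℕ} (u : Fin r → Fin d → ℝ) (a b : Fin r) : ℝ := ∑ p, u a p * u b p

/-- Kronecker delta -/
def dl {r : ℕ} (a b : Fin r) : ℝ := if a = b then 1 else 0

/-- the measure of `r` independent Gaussian vectors -/
def vecs (d r : ℕ) : Measure (Fin r → Fin d → ℝ) := Measure.pi fun _ => stdGaussianVec d

instance (d r : ℕ) : IsProbabilityMeasure (vecs d r) := by unfold vecs; infer_instance

lemma mp_eval (d r : ℕ) (a : Fin r) :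
    MeasurePreserving (fun u : Fin r → Fin d → ℝ => u a) (vecs d r) (stdGaussianVec d) :=
  measurePreserving_eval (fun _ : Fin r => stdGaussianVec d) a

lemma mp_pair (d r : ℕ) {a b : Fin r} (h : a ≠ b) :
    MeasurePreserving (fun u : Fin r → Fin d → ℝ => (u a, u b)) (vecs d r)
      ((stdGaussianVec d).prod (stdGaussianVec d)) := by
  refine ⟨by fun_prop, ?_⟩
  have hi : iIndepFun (fun (i : Fin r) (u : Fin r → Fin d → ℝ) => u i) (vecs d r) :=
    iIndepFun_pi (X := fun _ => id) (fun _ => aemeasurable_id)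
  have h2 := (indepFun_iff_map_prod_eq_prod_map_map (measurable_pi_apply a).aemeasurable
    (measurable_pi_apply b).aemeasurable).1 (hi.indepFun h)
  rw [h2, (mp_eval d r a).map_eq, (mp_eval d r b).map_eq]

lemma Dg_allLp (d r : ℕ) (a b : Fin r) : AllLp (vecs d r) (fun u => Dg u a b) :=
  AllLp.sum _ fun p => ((vec_allLp d p).comp (mp_eval d r a)).mul
    ((vec_allLp d p).comp (mp_eval d r b))

lemma Dg_dev (d r : ℕ) (hd : 0 < d) (a b : Fin r) :
    ∫ u, (Dg u a b - dl a b) ^ 2 ∂vecs d r ≤ (C4 + 1) / d := by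
  by_cases h : a = b
  · subst h
    have h1 := norm_sq_dev d hd
    rw [← (mp_eval d r a).map_eq, integral_map (mp_eval d r a).aemeasurable
      (Measurable.aestronglyMeasurable (by fun_prop))] at h1
    simp only [Dg, dl, if_true]
    refine h1.trans ?_
    gcongr; linarith
  · have h1 := dot_dev d hd
    rw [← (mp_pair d r h).map_eq, integral_map (by fun_prop)
      (Measurable.aestronglyMeasurable (by fun_prop))] at h1
    simp only [Dg, dl, if_neg h, sub_zero]
    refine h1.le.trans ?_
    gcongr; linarith [C4_nonneg]

lemma model_eq (d r : ℕ) : gaussianModel d r = (vecs d r).prod (vecs d r) := rfl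

lemma mp_fst (d r : ℕ) : MeasurePreserving Prod.fst (gaussianModel d r) (vecs d r) :=
  measurePreserving_fst

lemma mp_snd (d r : ℕ) : MeasurePreserving Prod.snd (gaussianModel d r) (vecs d r) :=
  measurePreserving_snd

/-- constant in the Gram bound -/
def Kc : ℝ := 3 * ((C4 + 1) ^ 2 + 2 * (C4 + 1))

lemma DD_allLp (d r : ℕ) (a b c e : Fin r) :
    AllLp (gaussianModel d r) (fun p => Dg p.1 a b * Dg p.2 c e) :=
  ((Dg_allLp d r a b).comp (mp_fst d r)).mul ((Dg_allLp d r c e).comp (mp_snd d r))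

lemma DD_dev (d r : ℕ) (hd : 0 < d) (a b c e : Fin r) :
    ∫ p, (Dg p.1 a b * Dg p.2 c e - dl a b * dl c e) ^ 2 ∂gaussianModel d r ≤ Kc / d := by
  set f : (Fin r → Fin d → ℝ) → ℝ := fun u => (Dg u a b - dl a b) ^ 2 with hf
  set g : (Fin r → Fin d → ℝ) → ℝ := fun u => (Dg u c e - dl c e) ^ 2 with hg
  have hfA : AllLp (vecs d r) f := ((Dg_allLp d r a b).sub (AllLp.const _)).pow 2
  have hgA : AllLp (vecs d r) g := ((Dg_allLp d r c e).sub (AllLp.const _)).pow 2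
  have hf1 : AllLp (gaussianModel d r) (fun p => f p.1) := hfA.comp (mp_fst d r)
  have hg1 : AllLp (gaussianModel d r) (fun p => g p.2) := hgA.comp (mp_snd d r)
  have hdl : ∀ x y : Fin r, 0 ≤ dl x y ∧ dl x y ≤ 1 := by
    intro x y; unfold dl; split_ifs <;> norm_num
  have hpt : ∀ p : (Fin r → Fin d → ℝ) × (Fin r → Fin d → ℝ),
      (Dg p.1 a b * Dg p.2 c e - dl a b * dl c e) ^ 2 ≤ 3 * (f p.1 * g p.2 + f p.1 + g p.2) := by
    intro p
    have h1 : dl a b ^ 2 ≤ 1 := by nlinarith [hdl a b]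
    have h2 : dl c e ^ 2 ≤ 1 := by nlinarith [hdl c e]
    simp only [hf, hg]
    generalize Dg p.1 a b = X at *
    generalize Dg p.2 c e = Y at *
    generalize dl a b = s at *
    generalize dl c e = t at *
    have e1 : X * Y - s * t = (X - s) * (Y - t) + t * (X - s) + s * (Y - t) := by ring
    rw [e1]
    have h3 : t ^ 2 * (X - s) ^ 2 ≤ (X - s) ^ 2 := by nlinarith [sq_nonneg (X - s)]
    have h4 : s ^ 2 * (Y - t) ^ 2 ≤ (Y - t) ^ 2 := by nlinarith [sq_nonneg (Y - t)]
    nlinarith [sq_nonneg ((X - s) * (Y - t) - t * (X - s)),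
      sq_nonneg ((X - s) * (Y - t) - s * (Y - t)), sq_nonneg (t * (X - s) - s * (Y - t))]
  have hκ : 0 ≤ (C4 + 1) / (d : ℝ) := div_nonneg (by linarith [C4_nonneg]) (by positivity)
  have hfi : ∫ p, f p.1 ∂gaussianModel d r ≤ (C4 + 1) / d := by
    have := integral_map (μ := gaussianModel d r) (mp_fst d r).aemeasurable
      (f := f) (by rw [(mp_fst d r).map_eq]; exact (hfA 1 (by simp)).aestronglyMeasurable)
    rw [← this, (mp_fst d r).map_eq]
    exact Dg_dev d r hd a b
  have hgi : ∫ p, g p.2 ∂gaussianModel d r ≤ (C4 + 1) / d := by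
    have := integral_map (μ := gaussianModel d r) (mp_snd d r).aemeasurable
      (f := g) (by rw [(mp_snd d r).map_eq]; exact (hgA 1 (by simp)).aestronglyMeasurable)
    rw [← this, (mp_snd d r).map_eq]
    exact Dg_dev d r hd c e
  have hfg : ∫ p, f p.1 * g p.2 ∂gaussianModel d r ≤ ((C4 + 1) / d) * ((C4 + 1) / d) := by
    rw [model_eq, integral_prod_mul]
    exact mul_le_mul (Dg_dev d r hd a b) (Dg_dev d r hd c e)
      (integral_nonneg fun u => sq_nonneg _) hκ
  calc _ ≤ ∫ p, 3 * (f p.1 * g p.2 + f p.1 + g p.2) ∂gaussianModel d r :=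
        integral_mono (((DD_allLp d r a b c e).sub (AllLp.const _)).pow 2).integrable
          ((AllLp.const 3).mul (((hf1.mul hg1).add hf1).add hg1)).integrable hpt
    _ = 3 * (∫ p, f p.1 * g p.2 ∂gaussianModel d r + ∫ p, f p.1 ∂gaussianModel d r
          + ∫ p, g p.2 ∂gaussianModel d r) := by
        rw [integral_const_mul, integral_add ((hf1.mul hg1).add hf1).integrable hg1.integrable,
          integral_add (hf1.mul hg1).integrable hf1.integrable]
    _ ≤ 3 * ((C4 + 1) / d * ((C4 + 1) / d) + (C4 + 1) / d + (C4 + 1) / d) := by gcongr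
    _ ≤ Kc / d := by
        have h1 : (1 : ℝ) ≤ d := by exact_mod_cast hd
        have h2 : (C4 + 1) / (d : ℝ) ≤ C4 + 1 := div_le_self (by linarith [C4_nonneg]) h1
        have h3 := mul_le_mul_of_nonneg_right h2 hκ
        have : Kc / (d : ℝ) = 3 * ((C4 + 1) * ((C4 + 1) / d) + (C4 + 1) / d + (C4 + 1) / d) := by
          unfold Kc; ring
        rw [this]; linarith

lemma comb_allLp (d r : ℕ) {L : Type*} [Fintype L] (c : L → ℝ) (i j k l : L → Fin r) :
    AllLp (gaussianModel d r) (fun p => ∑ x, c x * (Dg p.1 (i x) (j x) * Dg p.2 (k x) (l x))) :=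
  AllLp.sum _ fun _ => (AllLp.const _).mul (DD_allLp d r _ _ _ _)

lemma comb_dev (d r : ℕ) (hd : 0 < d) {L : Type*} [Fintype L] (c : L → ℝ) (i j k l : L → Fin r) :
    ∫ p, ((∑ x, c x * (Dg p.1 (i x) (j x) * Dg p.2 (k x) (l x))) -
      ∑ x, c x * (dl (i x) (j x) * dl (k x) (l x))) ^ 2 ∂gaussianModel d r
      ≤ (Fintype.card L * (∑ x, c x ^ 2) * Kc) / d := by
  have hA : ∀ x, AllLp (gaussianModel d r) (fun p => c x ^ 2 *
      (Dg p.1 (i x) (j x) * Dg p.2 (k x) (l x) - dl (i x) (j x) * dl (k x) (l x)) ^ 2) := fun x =>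
    (AllLp.const _).mul (((DD_allLp d r _ _ _ _).sub (AllLp.const _)).pow 2)
  calc _ ≤ ∫ p, (Fintype.card L : ℝ) * ∑ x, c x ^ 2 *
      (Dg p.1 (i x) (j x) * Dg p.2 (k x) (l x) - dl (i x) (j x) * dl (k x) (l x)) ^ 2
        ∂gaussianModel d r := by
        refine integral_mono (((comb_allLp d r c i j k l).sub (AllLp.const _)).pow 2).integrable
          ((AllLp.const _).mul (AllLp.sum _ hA)).integrable fun p => ?_
        simp only
        rw [← Finset.sum_sub_distrib]
        have := sq_sum_le_card_mul_sum_sq (s := Finset.univ) (f := fun x => c x * (Dg p.1 (i x) (j x) * Dg p.2 (k x) (l x)) - c x * (dl (i x) (j x) * dl (k x) (l x)))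
        refine this.trans (le_of_eq ?_)
        simp_rw [← mul_sub, mul_pow]
        rfl
    _ = (Fintype.card L : ℝ) * ∑ x, c x ^ 2 * ∫ p,
      (Dg p.1 (i x) (j x) * Dg p.2 (k x) (l x) - dl (i x) (j x) * dl (k x) (l x)) ^ 2
        ∂gaussianModel d r := by
        rw [integral_const_mul, integral_finsetSum _ fun x _ => (hA x).integrable]
        simp_rw [integral_const_mul]
    _ ≤ (Fintype.card L : ℝ) * ∑ x, c x ^ 2 * (Kc / d) := by
        gcongr with x
        exact DD_dev d r hd _ _ _ _
    _ = _ := by rw [← Finset.sum_mul]; ring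

/-! ### Part 4: the split model and its characteristic function -/

/-- the law of the remaining columns -/
def restM (d N : ℕ) : Measure (Fin N → (Fin d → ℝ) × (Fin d → ℝ)) :=
  Measure.pi fun _ => (stdGaussianVec d).prod (stdGaussianVec d)

instance (d N : ℕ) : IsProbabilityMeasure (restM d N) := by unfold restM; infer_instance

/-- scores among `r` distinguished columns, the others being given by `y` -/
def Sc {d r N : ℕ} (x : (Fin r → Fin d → ℝ) × (Fin r → Fin d → ℝ))
    (y : Fin N → (Fin d → ℝ) × (Fin d → ℝ)) (a b : Fin r) : ℝ :=
  ∑ p, x.1 a p * ∑ q, ((∑ c, x.1 c p * x.2 c q) + ∑ k, (y k).1 p * (y k).2 q) * x.2 b q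

/-- the coefficient matrix -/
def Am {d r : ℕ} (M : Fin r × Fin r → ℝ) (x : (Fin r → Fin d → ℝ) × (Fin r → Fin d → ℝ))
    (p q : Fin d) : ℝ := ∑ i, M i * (x.1 i.1 p * x.2 i.2 q)

/-- contribution of the distinguished columns -/
def TF {d r : ℕ} (M : Fin r × Fin r → ℝ) (x : (Fin r → Fin d → ℝ) × (Fin r → Fin d → ℝ)) : ℝ :=
  ∑ l : (Fin r × Fin r) × Fin r, M l.1 * (Dg x.1 l.1.1 l.2 * Dg x.2 l.2 l.1.2)

lemma T_split {d r N : ℕ} (M : Fin r × Fin r → ℝ)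
    (x : (Fin r → Fin d → ℝ) × (Fin r → Fin d → ℝ)) (y : Fin N → (Fin d → ℝ) × (Fin d → ℝ)) :
    ∑ i, M i * Sc x y i.1 i.2 = TF M x +
      ∑ k, ∑ q, (∑ p, Am M x p q * (y k).1 p) * (y k).2 q := by
  have h1 : ∀ a b, Sc x y a b = (∑ c, Dg x.1 a c * Dg x.2 c b) +
      ∑ k, ∑ q, ∑ p, (x.1 a p * x.2 b q) * (y k).1 p * (y k).2 q := by
    intro a b
    unfold Sc Dg
    simp_rw [add_mul, Finset.sum_add_distrib, mul_add, Finset.sum_add_distrib,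
      Finset.sum_mul_sum, Finset.sum_mul, Finset.mul_sum]
    congr 1
    · rw [Finset.sum_comm' (t' := Finset.univ) (s' := fun _ => Finset.univ) (by simp)]
      conv_rhs => rw [Finset.sum_comm' (t' := Finset.univ) (s' := fun _ => Finset.univ) (by simp)]
      rw [Finset.sum_comm]
      refine Finset.sum_congr rfl fun p _ => ?_
      rw [Finset.sum_comm]
      refine Finset.sum_congr rfl fun q _ => Finset.sum_congr rfl fun c _ => by ring
    · rw [Finset.sum_comm]
      simp_rw [fun q : Fin d => Finset.sum_comm (s := (Finset.univ : Finset (Fin d))) (t := (Finset.univ : Finset (Fin N))) (f := fun p k => x.1 a p * ((y k).1 p * (y k).2 q * x.2 b q))]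
      rw [Finset.sum_comm]
      refine Finset.sum_congr rfl fun k _ => Finset.sum_congr rfl fun q _ =>
        Finset.sum_congr rfl fun p _ => by ring
  simp_rw [h1, mul_add, Finset.sum_add_distrib]
  congr 1
  · unfold TF
    conv_rhs => rw [Fintype.sum_prod_type]
    simp_rw [Finset.mul_sum]
  · simp_rw [Finset.mul_sum]
    rw [Finset.sum_comm]
    refine Finset.sum_congr rfl fun k _ => ?_
    rw [Finset.sum_comm]
    refine Finset.sum_congr rfl fun q _ => ?_
    rw [Finset.sum_comm, Finset.sum_mul]
    refine Finset.sum_congr rfl fun p _ => ?_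
    unfold Am
    rw [Finset.sum_mul, Finset.sum_mul]
    refine Finset.sum_congr rfl fun i _ => by ring

lemma Fr_Am {d r : ℕ} (M : Fin r × Fin r → ℝ)
    (x : (Fin r → Fin d → ℝ) × (Fin r → Fin d → ℝ)) :
    Fr (Am M x) = ∑ l : (Fin r × Fin r) × (Fin r × Fin r), (M l.1 * M l.2) *
      (Dg x.1 l.1.1 l.2.1 * Dg x.2 l.1.2 l.2.2) := by
  unfold Fr Am Dg
  rw [Fintype.sum_prod_type]
  simp_rw [pow_two, Finset.sum_mul_sum, Finset.mul_sum]
  rw [Finset.sum_comm]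
  simp_rw [fun p : Fin d => Finset.sum_comm (s := (Finset.univ : Finset (Fin d))) (t := (Finset.univ : Finset (Fin r × Fin r))) (f := fun q i => ∑ j, M i * (x.1 i.1 p * x.2 i.2 q) * (M j * (x.1 j.1 p * x.2 j.2 q)))]
  rw [Finset.sum_comm]
  refine Finset.sum_congr rfl fun i _ => ?_
  simp_rw [fun p : Fin d => Finset.sum_comm (s := (Finset.univ : Finset (Fin d))) (t := (Finset.univ : Finset (Fin r × Fin r))) (f := fun q j => M i * (x.1 i.1 p * x.2 i.2 q) * (M j * (x.1 j.1 p * x.2 j.2 q)))]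
  rw [Finset.sum_comm]
  refine Finset.sum_congr rfl fun j _ => Finset.sum_congr rfl fun p _ =>
    Finset.sum_congr rfl fun q _ => by ring

/-- trace -/
def trM {r : ℕ} (M : Fin r × Fin r → ℝ) : ℝ := ∑ i, M i * dl i.1 i.2

/-- squared norm -/
def qM {r : ℕ} (M : Fin r × Fin r → ℝ) : ℝ := ∑ i, M i ^ 2

lemma trM_eq {r : ℕ} (M : Fin r × Fin r → ℝ) :
    trM M = ∑ l : (Fin r × Fin r) × Fin r, M l.1 * (dl l.1.1 l.2 * dl l.2 l.1.2) := by
  rw [Fintype.sum_prod_type]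
  simp [trM, dl]

lemma qM_eq {r : ℕ} (M : Fin r × Fin r → ℝ) :
    qM M = ∑ l : (Fin r × Fin r) × (Fin r × Fin r), (M l.1 * M l.2) *
      (dl l.1.1 l.2.1 * dl l.1.2 l.2.2) := by
  rw [Fintype.sum_prod_type]
  simp only [qM, dl]
  refine Finset.sum_congr rfl fun i _ => ?_
  rw [Finset.sum_eq_single i]
  · simp [pow_two]
  · intro j _ hj
    by_cases h1 : i.1 = j.1
    · have h2 : i.2 ≠ j.2 := fun h => hj (Prod.ext h1.symm h.symm)
      simp [h2]
    · simp [h1]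
  · simp

lemma cf_rest {d N : ℕ} (A : Fin d → Fin d → ℝ) :
    ∫ y, Complex.exp (((∑ k, ∑ q, (∑ p, A p q * (y k).1 p) * (y k).2 q : ℝ) : ℂ) * Complex.I)
      ∂restM d N = (phiA A : ℂ) ^ N := by
  have h1 : ∀ y : Fin N → (Fin d → ℝ) × (Fin d → ℝ),
      Complex.exp (((∑ k, ∑ q, (∑ p, A p q * (y k).1 p) * (y k).2 q : ℝ) : ℂ) * Complex.I)
      = ∏ k, Complex.exp (((∑ q, (∑ p, A p q * (y k).1 p) * (y k).2 q : ℝ) : ℂ) * Complex.I) := by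
    intro y
    rw [← Complex.exp_sum, ← Finset.sum_mul]
    congr 2
    rw [Complex.ofReal_sum]
  simp_rw [h1]
  unfold restM
  rw [integral_fintype_prod_eq_prod (fun (_ : Fin N) (z : (Fin d → ℝ) × (Fin d → ℝ)) =>
    Complex.exp (((∑ q, (∑ p, A p q * z.1 p) * z.2 q : ℝ) : ℂ) * Complex.I))]
  simp only [cf_bilin, Finset.prod_const, Finset.card_univ, Fintype.card_fin]

lemma Sc_meas {d r N : ℕ} (a b : Fin r) : Measurable
    (fun z : ((Fin r → Fin d → ℝ) × (Fin r → Fin d → ℝ)) × (Fin N → (Fin d → ℝ) × (Fin d → ℝ)) =>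
      Sc z.1 z.2 a b) := by
  unfold Sc; fun_prop

lemma cf_int {d r N : ℕ} (M : Fin r × Fin r → ℝ) : Integrable
    (fun z : ((Fin r → Fin d → ℝ) × (Fin r → Fin d → ℝ)) × (Fin N → (Fin d → ℝ) × (Fin d → ℝ)) =>
      Complex.exp (((∑ i, M i * Sc z.1 z.2 i.1 i.2 : ℝ) : ℂ) * Complex.I))
    ((gaussianModel d r).prod (restM d N)) := by
  refine Integrable.of_bound (C := 1) ?_ (ae_of_all _ fun z => ?_)
  · have : Measurable (fun z : ((Fin r → Fin d → ℝ) × (Fin r → Fin d → ℝ)) ×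
        (Fin N → (Fin d → ℝ) × (Fin d → ℝ)) => ∑ i, M i * Sc z.1 z.2 i.1 i.2) :=
      Finset.measurable_sum _ fun i _ => (Sc_meas _ _).const_mul _
    exact (by fun_prop : Measurable _).aestronglyMeasurable
  · rw [Complex.norm_exp_ofReal_mul_I]

lemma cf_inner {d r N : ℕ} (M : Fin r × Fin r → ℝ)
    (x : (Fin r → Fin d → ℝ) × (Fin r → Fin d → ℝ)) :
    ∫ y, Complex.exp (((∑ i, M i * Sc x y i.1 i.2 : ℝ) : ℂ) * Complex.I) ∂restM d N
      = Complex.exp ((TF M x : ℂ) * Complex.I) * (phiA (Am M x) : ℂ) ^ N := by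
  rw [← cf_rest, ← integral_const_mul]
  congr 1; ext y
  rw [T_split, Complex.ofReal_add, add_mul, Complex.exp_add]

lemma abs_pow_sub_le {a b : ℝ} (ha : 0 ≤ a) (ha1 : a ≤ 1) (hb : 0 ≤ b) (hb1 : b ≤ 1) (N : ℕ) :
    |a ^ N - b ^ N| ≤ N * |a - b| := by
  induction N with
  | zero => simp
  | succ k ih =>
    have : a ^ (k + 1) - b ^ (k + 1) = a ^ k * (a - b) + b * (a ^ k - b ^ k) := by ring
    rw [this]
    refine (abs_add_le _ _).trans ?_
    rw [abs_mul, abs_mul, abs_of_nonneg (pow_nonneg ha k), abs_of_nonneg hb]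
    have h1 : a ^ k ≤ 1 := pow_le_one₀ ha ha1
    have h2 := mul_le_mul_of_nonneg_right h1 (abs_nonneg (a - b))
    have h3 := mul_le_mul_of_nonneg_right hb1 (abs_nonneg (a ^ k - b ^ k))
    push_cast
    linarith

lemma exp_I_lip (s t : ℝ) :
    ‖Complex.exp ((s : ℂ) * Complex.I) - Complex.exp ((t : ℂ) * Complex.I)‖ ≤ |s - t| := by
  have h : Complex.exp ((s : ℂ) * Complex.I) - Complex.exp ((t : ℂ) * Complex.I)
      = Complex.exp ((t : ℂ) * Complex.I) * (Complex.exp (Complex.I * ((s - t : ℝ) : ℂ)) - 1) := by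
    rw [mul_sub, ← Complex.exp_add, mul_one]; congr 2; push_cast; ring
  rw [h, norm_mul, Complex.norm_exp_ofReal_mul_I, one_mul]
  exact Real.norm_exp_I_mul_ofReal_sub_one_le

lemma cf_pointwise {d r N : ℕ} (α : ℝ) (M : Fin r × Fin r → ℝ)
    (x : (Fin r → Fin d → ℝ) × (Fin r → Fin d → ℝ)) :
    ‖Complex.exp ((TF M x : ℂ) * Complex.I) * (phiA (Am M x) : ℂ) ^ N -
      Complex.exp ((trM M : ℂ) * Complex.I) * ((Real.exp (-(α * qM M / 2)) : ℝ) : ℂ)‖ ≤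
    |TF M x - trM M| + (N / d ^ 2 / 2) * |Fr (Am M x) - qM M|
      + (N / d ^ 4 / 8) * (C4 * Fr (Am M x) ^ 2 + qM M ^ 2)
      + |Real.exp (-(N / d ^ 2 * qM M / 2)) - Real.exp (-(α * qM M / 2))| := by
  have hq : 0 ≤ qM M := by unfold qM; positivity
  set φ := phiA (Am M x)
  set F := Fr (Am M x)
  set q := qM M
  have h0 := phiA_nonneg (Am M x)
  have h1 := phiA_le_one (Am M x)
  have hap := phiA_approx (Am M x)
  have e1 : Complex.exp ((TF M x : ℂ) * Complex.I) * (φ : ℂ) ^ N -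
      Complex.exp ((trM M : ℂ) * Complex.I) * ((Real.exp (-(α * q / 2)) : ℝ) : ℂ)
      = (Complex.exp ((TF M x : ℂ) * Complex.I) - Complex.exp ((trM M : ℂ) * Complex.I)) * ((φ ^ N : ℝ) : ℂ)
        + Complex.exp ((trM M : ℂ) * Complex.I) * ((φ ^ N - Real.exp (-(α * q / 2)) : ℝ) : ℂ) := by
    push_cast; ring
  rw [e1]
  refine (norm_add_le _ _).trans ?_
  rw [norm_mul, norm_mul, Complex.norm_exp_ofReal_mul_I, one_mul, Complex.norm_real, Complex.norm_real,
    Real.norm_eq_abs, Real.norm_eq_abs, abs_of_nonneg (pow_nonneg h0 N)]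
  have h2 := exp_I_lip (TF M x) (trM M)
  have h3 : ‖Complex.exp ((TF M x : ℂ) * Complex.I) - Complex.exp ((trM M : ℂ) * Complex.I)‖ * φ ^ N
      ≤ |TF M x - trM M| :=
    (mul_le_of_le_one_right (norm_nonneg _) (pow_le_one₀ h0 h1)).trans h2
  set b := Real.exp (-(q / (2 * d ^ 2)))
  have hb0 : 0 ≤ b := (Real.exp_pos _).le
  have hb1 : b ≤ 1 := Real.exp_le_one_iff.2 (by simp only [Left.neg_nonpos_iff]; positivity)
  have hbN : b ^ N = Real.exp (-(N / d ^ 2 * q / 2)) := by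
    rw [← Real.exp_nat_mul]; congr 1; ring
  have h4 := abs_pow_sub_le h0 h1 hb0 hb1 N
  have hbt : |b - (1 - q / (2 * d ^ 2))| ≤ (q / (2 * d ^ 2)) ^ 2 / 2 := exp_taylor (by positivity)
  have h5 : |φ - b| ≤ |F - q| / (2 * d ^ 2) + C4 * F ^ 2 / (8 * d ^ 4) + q ^ 2 / (8 * d ^ 4) := by
    have e2 : φ - b = (φ - (1 - F / (2 * d ^ 2))) + (-((F - q) / (2 * d ^ 2)))
       + (-(b - (1 - q / (2 * d ^ 2)))) := by ring
    rw [e2]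
    refine (abs_add_le _ _).trans ?_
    have := abs_add_le (φ - (1 - F / (2 * d ^ 2))) (-((F - q) / (2 * d ^ 2)))
    rw [abs_neg, abs_div, abs_of_nonneg (by positivity : (0 : ℝ) ≤ 2 * (d : ℝ) ^ 2)] at this
    rw [abs_neg]
    have e3 : (q / (2 * (d : ℝ) ^ 2)) ^ 2 / 2 = q ^ 2 / (8 * d ^ 4) := by rw [div_pow]; ring
    linarith
  have h6 : |φ ^ N - Real.exp (-(α * q / 2))| ≤ |φ ^ N - b ^ N| + |b ^ N - Real.exp (-(α * q / 2))| :=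
    abs_sub_le _ _ _
  have h7 : (N : ℝ) * |φ - b| ≤ (N / d ^ 2 / 2) * |F - q| + (N / d ^ 4 / 8) * (C4 * F ^ 2 + q ^ 2) := by
    refine (mul_le_mul_of_nonneg_left h5 (by positivity)).trans (le_of_eq ?_)
    ring
  rw [hbN] at h4 h6
  linarith

/-! ### Part 5: convergence of characteristic functions and weak convergence -/

lemma cf_bound {r : ℕ} (α : ℝ) (M : Fin r × Fin r → ℝ) :
    ∃ C1 C2 : ℝ, ∀ d N : ℕ, 0 < d →
    ‖∫ z, Complex.exp (((∑ i, M i * Sc z.1 z.2 i.1 i.2 : ℝ) : ℂ) * Complex.I)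
        ∂((gaussianModel d r).prod (restM d N)) -
      Complex.exp ((trM M : ℂ) * Complex.I) * ((Real.exp (-(α * qM M / 2)) : ℝ) : ℂ)‖ ≤
    Real.sqrt (C1 * (1 / d)) + ((N / d ^ 2) / 2) * Real.sqrt (C2 * (1 / d))
      + ((N / d ^ 2) * (1 / d) ^ 2 / 8) * (C4 * (2 * (C2 * (1 / d)) + 2 * qM M ^ 2) + qM M ^ 2)
      + |Real.exp (-((N / d ^ 2) * qM M / 2)) - Real.exp (-(α * qM M / 2))| := by
  refine ⟨Fintype.card ((Fin r × Fin r) × Fin r) * (∑ x : (Fin r × Fin r) × Fin r, M x.1 ^ 2) * Kc,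
    Fintype.card ((Fin r × Fin r) × (Fin r × Fin r)) *
      (∑ x : (Fin r × Fin r) × (Fin r × Fin r), (M x.1 * M x.2) ^ 2) * Kc, ?_⟩
  intro d N hd
  set C1 : ℝ := Fintype.card ((Fin r × Fin r) × Fin r) *
    (∑ x : (Fin r × Fin r) × Fin r, M x.1 ^ 2) * Kc
  set C2 : ℝ := Fintype.card ((Fin r × Fin r) × (Fin r × Fin r)) *
      (∑ x : (Fin r × Fin r) × (Fin r × Fin r), (M x.1 * M x.2) ^ 2) * Kc
  have hT : AllLp (gaussianModel d r) (fun x => TF M x - trM M) :=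
    (comb_allLp d r (fun l : (Fin r × Fin r) × Fin r => M l.1) (fun l => l.1.1) (fun l => l.2)
      (fun l => l.2) (fun l => l.1.2)).sub (AllLp.const _)
  have hT2 : ∫ x, (TF M x - trM M) ^ 2 ∂gaussianModel d r ≤ C1 * (1 / d) := by
    have := comb_dev d r hd (fun l : (Fin r × Fin r) × Fin r => M l.1) (fun l => l.1.1)
      (fun l => l.2) (fun l => l.2) (fun l => l.1.2)
    rw [← trM_eq] at this
    rw [mul_one_div]
    exact this
  have hF0 : AllLp (gaussianModel d r) (fun x => Fr (Am M x)) := by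
    simp_rw [Fr_Am]
    exact comb_allLp d r (fun l : (Fin r × Fin r) × (Fin r × Fin r) => M l.1 * M l.2)
      (fun l => l.1.1) (fun l => l.2.1) (fun l => l.1.2) (fun l => l.2.2)
  have hF : AllLp (gaussianModel d r) (fun x => Fr (Am M x) - qM M) := hF0.sub (AllLp.const _)
  have hF2 : ∫ x, (Fr (Am M x) - qM M) ^ 2 ∂gaussianModel d r ≤ C2 * (1 / d) := by
    have := comb_dev d r hd (fun l : (Fin r × Fin r) × (Fin r × Fin r) => M l.1 * M l.2)
      (fun l => l.1.1) (fun l => l.2.1) (fun l => l.1.2) (fun l => l.2.2)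
    rw [← qM_eq] at this
    simp_rw [← Fr_Am] at this
    rw [mul_one_div]
    exact this
  have hF3 : ∫ x, Fr (Am M x) ^ 2 ∂gaussianModel d r ≤ 2 * (C2 * (1 / d)) + 2 * qM M ^ 2 := by
    calc _ ≤ ∫ x, (2 * (Fr (Am M x) - qM M) ^ 2 + 2 * qM M ^ 2) ∂gaussianModel d r := by
          refine integral_mono (hF0.pow 2).integrable
            (((AllLp.const 2).mul (hF.pow 2)).add (AllLp.const _)).integrable fun x => ?_
          simp only
          nlinarith [sq_nonneg (Fr (Am M x) - 2 * qM M)]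
      _ = 2 * ∫ x, (Fr (Am M x) - qM M) ^ 2 ∂gaussianModel d r + 2 * qM M ^ 2 := by
          rw [integral_add ((AllLp.const 2).mul (hF.pow 2)).integrable (integrable_const _),
            integral_const_mul]
          simp
      _ ≤ _ := by gcongr
  have hT1 : ∫ x, |TF M x - trM M| ∂gaussianModel d r ≤ Real.sqrt (C1 * (1 / d)) :=
    Real.le_sqrt_of_sq_le ((sq_integral_abs_le hT).trans hT2)
  have hF1 : ∫ x, |Fr (Am M x) - qM M| ∂gaussianModel d r ≤ Real.sqrt (C2 * (1 / d)) :=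
    Real.le_sqrt_of_sq_le ((sq_integral_abs_le hF).trans hF2)
  have hint := (cf_int (d := d) (N := N) M).integral_prod_left
  rw [integral_prod _ (cf_int M)]
  simp_rw [cf_inner] at hint ⊢
  set c : ℂ := Complex.exp ((trM M : ℂ) * Complex.I) * ((Real.exp (-(α * qM M / 2)) : ℝ) : ℂ)
    with hc
  have e0 : c = ∫ _, c ∂gaussianModel d r := by simp
  rw [e0, ← integral_sub hint (integrable_const _)]
  have iT := hT.abs.integrable
  have iF := (((AllLp.const ((N / d ^ 2 : ℝ) / 2)).mul hF.abs)).integrable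
  have iF2 := ((AllLp.const ((N / d ^ 4 : ℝ) / 8)).mul
    (((AllLp.const C4).mul (hF0.pow 2)).add (AllLp.const (qM M ^ 2)))).integrable
  have iE : Integrable (fun _ => |Real.exp (-(N / d ^ 2 * qM M / 2)) - Real.exp (-(α * qM M / 2))|)
    (gaussianModel d r) := integrable_const _
  refine (norm_integral_le_of_norm_le (((iT.add iF).add iF2).add iE)
    (ae_of_all _ fun x => cf_pointwise α M x)).trans ?_
  have e1 := integral_add ((iT.add iF).add iF2) iE
  have e2 := integral_add (iT.add iF) iF2
  have e3 := integral_add iT iF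
  simp only [Pi.add_apply] at e1 e2 e3 ⊢
  rw [e1, e2, e3, integral_const_mul, integral_const_mul,
    integral_add ((AllLp.const C4).mul (hF0.pow 2)).integrable (integrable_const _),
    integral_const_mul]
  simp only [integral_const, probReal_univ, one_smul]
  have e4 : (N : ℝ) / d ^ 2 * (1 / d) ^ 2 / 8 = N / d ^ 4 / 8 := by
    ring
  rw [e4]
  have := C4_nonneg
  gcongr

lemma clt_cf {r : ℕ} (α : ℝ) (M : Fin r × Fin r → ℝ) (d N : ℕ → ℕ)
    (hd : Tendsto d atTop atTop)
    (hN : Tendsto (fun m => (N m : ℝ) / (d m : ℝ) ^ 2) atTop (𝓝 α)) :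
    Tendsto (fun m => ∫ z, Complex.exp (((∑ i, M i * Sc z.1 z.2 i.1 i.2 : ℝ) : ℂ) * Complex.I)
        ∂((gaussianModel (d m) r).prod (restM (d m) (N m)))) atTop
      (𝓝 (Complex.exp ((trM M : ℂ) * Complex.I) * ((Real.exp (-(α * qM M / 2)) : ℝ) : ℂ))) := by
  obtain ⟨C1, C2, h⟩ := cf_bound (r := r) α M
  rw [tendsto_iff_norm_sub_tendsto_zero]
  have hinv : Tendsto (fun m => 1 / (d m : ℝ)) atTop (𝓝 0) :=
    tendsto_one_div_atTop_nhds_zero_nat.comp hd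
  set g : ℝ × ℝ → ℝ := fun w => Real.sqrt (C1 * w.2) + (w.1 / 2) * Real.sqrt (C2 * w.2)
      + (w.1 * w.2 ^ 2 / 8) * (C4 * (2 * (C2 * w.2) + 2 * qM M ^ 2) + qM M ^ 2)
      + |Real.exp (-(w.1 * qM M / 2)) - Real.exp (-(α * qM M / 2))| with hg
  have hgc : Continuous g := by rw [hg]; fun_prop
  have hg0 : g (α, 0) = 0 := by simp [hg]
  have hlim := (hgc.tendsto (α, 0)).comp (hN.prodMk_nhds hinv)
  rw [hg0] at hlim
  refine squeeze_zero' (Eventually.of_forall fun m => norm_nonneg _) ?_ hlim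
  filter_upwards [hd.eventually_gt_atTop 0] with m hm
  exact h (d m) (N m) hm

/-- score map into Euclidean space -/
def ScE {d r N : ℕ}
    (z : ((Fin r → Fin d → ℝ) × (Fin r → Fin d → ℝ)) × (Fin N → (Fin d → ℝ) × (Fin d → ℝ))) :
    EuclideanSpace ℝ (Fin r × Fin r) := WithLp.toLp 2 fun i => Sc z.1 z.2 i.1 i.2

lemma ScE_meas {d r N : ℕ} : Measurable (ScE (d := d) (r := r) (N := N)) := by
  unfold ScE
  refine (WithLp.measurable_toLp 2 _).comp (measurable_pi_iff.2 fun i => Sc_meas _ _)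

/-- law of the scores -/
def QE (r d N : ℕ) : ProbabilityMeasure (EuclideanSpace ℝ (Fin r × Fin r)) :=
  ⟨((gaussianModel d r).prod (restM d N)).map ScE,
    Measure.isProbabilityMeasure_map ScE_meas.aemeasurable⟩

/-- standard Gaussian matrix -/
def gM (r : ℕ) : Measure (Fin r × Fin r → ℝ) := Measure.pi fun _ => gaussianReal 0 1

instance (r : ℕ) : IsProbabilityMeasure (gM r) := by unfold gM; infer_instance

/-- limit map -/
def limMap {r : ℕ} (α : ℝ) (z : Fin r × Fin r → ℝ) : EuclideanSpace ℝ (Fin r × Fin r) :=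
  WithLp.toLp 2 fun i => dl i.1 i.2 + Real.sqrt α * z i

lemma limMap_meas {r : ℕ} (α : ℝ) : Measurable (limMap (r := r) α) := by
  unfold limMap
  refine (WithLp.measurable_toLp 2 _).comp (measurable_pi_iff.2 fun i => by fun_prop)

/-- limit law -/
def QLim (r : ℕ) (α : ℝ) : ProbabilityMeasure (EuclideanSpace ℝ (Fin r × Fin r)) :=
  ⟨(gM r).map (limMap α), Measure.isProbabilityMeasure_map (limMap_meas α).aemeasurable⟩

lemma QE_cf (r d N : ℕ) (t : EuclideanSpace ℝ (Fin r × Fin r)) :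
    charFun (QE r d N : Measure (EuclideanSpace ℝ (Fin r × Fin r))) t =
    ∫ z, Complex.exp (((∑ i, t i * Sc z.1 z.2 i.1 i.2 : ℝ) : ℂ) * Complex.I)
        ∂((gaussianModel d r).prod (restM d N)) := by
  rw [charFun_apply]
  change ∫ x, _ ∂(((gaussianModel d r).prod (restM d N)).map ScE) = _
  rw [integral_map ScE_meas.aemeasurable (by fun_prop)]
  simp [PiLp.inner_apply, ScE]

lemma QLim_cf (r : ℕ) {α : ℝ} (hα : 0 < α) (t : EuclideanSpace ℝ (Fin r × Fin r)) :
    charFun (QLim r α : Measure (EuclideanSpace ℝ (Fin r × Fin r))) t =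
    Complex.exp ((trM t : ℂ) * Complex.I) * ((Real.exp (-(α * qM t / 2)) : ℝ) : ℂ) := by
  rw [charFun_apply]
  change ∫ x, _ ∂((gM r).map (limMap α)) = _
  rw [integral_map (limMap_meas α).aemeasurable (by fun_prop)]
  have h1 : ∀ z : Fin r × Fin r → ℝ,
      Complex.exp (((inner ℝ (limMap α z) t : ℝ) : ℂ) * Complex.I) =
      Complex.exp ((trM t : ℂ) * Complex.I) *
        ∏ i, Complex.exp (((Real.sqrt α * t i : ℝ) : ℂ) * (z i : ℂ) * Complex.I) := by
    intro z
    rw [← Complex.exp_sum, ← Complex.exp_add, ← Finset.sum_mul, ← add_mul]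
    congr 2
    have : (inner ℝ (limMap α z) t : ℝ) = trM t + ∑ i, Real.sqrt α * t i * z i := by
      simp only [PiLp.inner_apply, limMap, trM, ← Finset.sum_add_distrib]
      refine Finset.sum_congr rfl fun i _ => ?_
      simp
      ring
    rw [this]; push_cast; rfl
  simp_rw [h1]
  rw [integral_const_mul]
  unfold gM
  rw [integral_fintype_prod_eq_prod (fun i (x : ℝ) =>
    Complex.exp (((Real.sqrt α * t i : ℝ) : ℂ) * (x : ℂ) * Complex.I))]
  simp_rw [← charFun_apply_real, charFun_gaussianReal]
  rw [← Complex.exp_sum, Complex.ofReal_exp]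
  congr 2
  have e : ∀ i, -((α * t i ^ 2 / 2 : ℝ) : ℂ) = ((Real.sqrt α * t i : ℝ) : ℂ) * ((0 : ℝ) : ℂ) * Complex.I
      - (((1 : NNReal) : ℝ) : ℂ) * ((Real.sqrt α * t i : ℝ) : ℂ) ^ 2 / 2 := by
    intro i
    rw [← Complex.ofReal_pow, mul_pow, Real.sq_sqrt hα.le]
    push_cast; ring
  simp_rw [← e]
  rw [qM, Finset.mul_sum, Finset.sum_div]
  push_cast
  rw [Finset.sum_neg_distrib]

lemma QE_tendsto (r : ℕ) {α : ℝ} (hα : 0 < α) (d N : ℕ → ℕ)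
    (hd : Tendsto d atTop atTop)
    (hN : Tendsto (fun m => (N m : ℝ) / (d m : ℝ) ^ 2) atTop (𝓝 α)) :
    Tendsto (fun m => QE r (d m) (N m)) atTop (𝓝 (QLim r α)) := by
  refine ProbabilityMeasure.tendsto_of_tendsto_charFun fun t => ?_
  rw [QLim_cf r hα]
  simp_rw [QE_cf]
  exact clt_cf α _ d N hd hN

/-! ### Part 6: the law of the scores at an injective choice of columns -/

lemma exists_split_equiv {r n : ℕ} (e : Fin r → Fin n) (he : Function.Injective e) :
    ∃ E : Fin r ⊕ Fin (n - r) ≃ Fin n, ∀ a, E (Sum.inl a) = e a := by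
  classical
  have hc : Fintype.card ((Set.range e)ᶜ : Set (Fin n)) = n - r := by
    rw [Fintype.card_compl_set, Set.card_range_of_injective he]; simp
  refine ⟨(Equiv.sumCongr (Equiv.ofInjective e he) (Fintype.equivFinOfCardEq hc).symm).trans
    (Equiv.Set.sumCompl (Set.range e)), fun a => ?_⟩
  simp

lemma exists_mp {d r n : ℕ} (e : Fin r → Fin n) (he : Function.Injective e) :
    ∃ Ψ : ((Fin r → Fin d → ℝ) × (Fin r → Fin d → ℝ)) × (Fin (n - r) → (Fin d → ℝ) × (Fin d → ℝ)) →
      (Fin n → Fin d → ℝ) × (Fin n → Fin d → ℝ),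
      MeasurePreserving Ψ ((gaussianModel d r).prod (restM d (n - r))) (gaussianModel d n) ∧
      ∀ z a b, scoreX (Ψ z).1 (Ψ z).2 (e a) (e b) = Sc z.1 z.2 a b := by
  obtain ⟨E, hE⟩ := exists_split_equiv e he
  have h1 : MeasurePreserving
      (MeasurableEquiv.arrowProdEquivProdArrow (Fin d → ℝ) (Fin d → ℝ) (Fin r)).symm
      (gaussianModel d r) (restM d r) :=
    (measurePreserving_arrowProdEquivProdArrow (Fin d → ℝ) (Fin d → ℝ) (Fin r)
      (fun _ => stdGaussianVec d) (fun _ => stdGaussianVec d)).symm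
  have h1' := h1.prod (MeasurePreserving.id (restM d (n - r)))
  have h2 := measurePreserving_sumPiEquivProdPi_symm (ι := Fin r) (ι' := Fin (n - r))
    (X := fun _ => (Fin d → ℝ) × (Fin d → ℝ))
    (fun _ => (stdGaussianVec d).prod (stdGaussianVec d))
  have h3 := measurePreserving_piCongrLeft (α := fun _ : Fin n => (Fin d → ℝ) × (Fin d → ℝ))
    (fun _ => (stdGaussianVec d).prod (stdGaussianVec d)) E
  have h4 := measurePreserving_arrowProdEquivProdArrow (Fin d → ℝ) (Fin d → ℝ) (Fin n)
      (fun _ => stdGaussianVec d) (fun _ => stdGaussianVec d)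
  have h := h4.comp (h3.comp (h2.comp h1'))
  refine ⟨_, h, fun z a b => ?_⟩
  set Ψ := (MeasurableEquiv.arrowProdEquivProdArrow (Fin d → ℝ) (Fin d → ℝ) (Fin n)) ∘
    (MeasurableEquiv.piCongrLeft (fun _ : Fin n => (Fin d → ℝ) × (Fin d → ℝ)) E) ∘
    (MeasurableEquiv.sumPiEquivProdPi (fun _ : Fin r ⊕ Fin (n - r) => (Fin d → ℝ) × (Fin d → ℝ))).symm ∘
    (Prod.map (MeasurableEquiv.arrowProdEquivProdArrow (Fin d → ℝ) (Fin d → ℝ) (Fin r)).symm id)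
  have hl1 : ∀ a, (Ψ z).1 (E (Sum.inl a)) = z.1.1 a := by
    intro a
    change (((Equiv.piCongrLeft (fun _ : Fin n => (Fin d → ℝ) × (Fin d → ℝ)) E) _) (E (Sum.inl a))).1 = _
    rw [Equiv.piCongrLeft_apply_apply]; rfl
  have hl2 : ∀ a, (Ψ z).2 (E (Sum.inl a)) = z.1.2 a := by
    intro a
    change (((Equiv.piCongrLeft (fun _ : Fin n => (Fin d → ℝ) × (Fin d → ℝ)) E) _) (E (Sum.inl a))).2 = _
    rw [Equiv.piCongrLeft_apply_apply]; rfl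
  have hr1 : ∀ k, (Ψ z).1 (E (Sum.inr k)) = (z.2 k).1 := by
    intro a
    change (((Equiv.piCongrLeft (fun _ : Fin n => (Fin d → ℝ) × (Fin d → ℝ)) E) _) (E (Sum.inr a))).1 = _
    rw [Equiv.piCongrLeft_apply_apply]; rfl
  have hr2 : ∀ k, (Ψ z).2 (E (Sum.inr k)) = (z.2 k).2 := by
    intro a
    change (((Equiv.piCongrLeft (fun _ : Fin n => (Fin d → ℝ) × (Fin d → ℝ)) E) _) (E (Sum.inr a))).2 = _
    rw [Equiv.piCongrLeft_apply_apply]; rfl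
  change scoreX (Ψ z).1 (Ψ z).2 (e a) (e b) = _
  rw [← hE a, ← hE b]
  simp only [scoreX, dotProduct, Matrix.mulVec, Wcross, Matrix.of_apply, Sc]
  rw [hl1, hl2]
  refine Finset.sum_congr rfl fun p _ => ?_
  congr 1
  refine Finset.sum_congr rfl fun q _ => ?_
  congr 1
  rw [← E.sum_comp, Fintype.sum_sum_type]
  simp_rw [hl1, hl2, hr1, hr2]

lemma scoreX_meas {d n : ℕ} (j i : Fin n) : Measurable
    (fun p : (Fin n → Fin d → ℝ) × (Fin n → Fin d → ℝ) => scoreX p.1 p.2 j i) := by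
  simp only [scoreX, dotProduct, Matrix.mulVec, Wcross, Matrix.of_apply]
  fun_prop

/-- transfer of integrals to the law `QE` -/
lemma integral_scores {d r n : ℕ} (e : Fin r → Fin n) (he : Function.Injective e)
    (F : EuclideanSpace ℝ (Fin r × Fin r) → ℝ) (hF : Measurable F) :
    ∫ p, F (WithLp.toLp 2 fun i => scoreX p.1 p.2 (e i.1) (e i.2)) ∂gaussianModel d n
      = ∫ s, F s ∂(QE r d (n - r) : Measure (EuclideanSpace ℝ (Fin r × Fin r))) := by
  obtain ⟨Ψ, hΨ, hs⟩ := exists_mp (d := d) e he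
  change _ = ∫ x, _ ∂(((gaussianModel d r).prod (restM d (n - r))).map ScE)
  have hm : Measurable (fun p : (Fin n → Fin d → ℝ) × (Fin n → Fin d → ℝ) =>
      (WithLp.toLp 2 fun i : Fin r × Fin r => scoreX p.1 p.2 (e i.1) (e i.2) :
        EuclideanSpace ℝ (Fin r × Fin r))) :=
    (WithLp.measurable_toLp 2 _).comp (measurable_pi_iff.2 fun i => scoreX_meas _ _)
  rw [integral_map ScE_meas.aemeasurable hF.aestronglyMeasurable]
  have hFm : Measurable (fun p : (Fin n → Fin d → ℝ) × (Fin n → Fin d → ℝ) =>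
      F (WithLp.toLp 2 fun i : Fin r × Fin r => scoreX p.1 p.2 (e i.1) (e i.2))) := hF.comp hm
  rw [← hΨ.map_eq, integral_map hΨ.aemeasurable hFm.aestronglyMeasurable]
  simp_rw [hs]
  rfl

/-! ### Part 7: the limiting law -/

lemma Phi_eq_integral (x : ℝ) :
    Phi x = ∫ z, (if z ≤ x then (1 : ℝ) else 0) ∂gaussianReal 0 1 := by
  have : (fun z : ℝ => if z ≤ x then (1 : ℝ) else 0) = (Set.Iic x).indicator 1 := by
    ext z; simp [Set.indicator_apply]
  rw [this, integral_indicator_one measurableSet_Iic]; rfl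

lemma Phi_nonneg (x : ℝ) : 0 ≤ Phi x := ENNReal.toReal_nonneg

lemma Phi_le_one (x : ℝ) : Phi x ≤ 1 := by
  unfold Phi
  exact measureReal_le_one

lemma Phi_continuous : Continuous Phi := by
  rw [continuous_iff_continuousAt]
  intro x
  have h : Phi = fun x => ∫ z, (if z ≤ x then (1 : ℝ) else 0) ∂gaussianReal 0 1 :=
    funext Phi_eq_integral
  rw [h]
  have : NullSingletonClass (gaussianReal 0 1) := nullSingletonClass_gaussianReal one_ne_zero
  refine continuousAt_of_dominated (bound := fun _ => 1) ?_ ?_ (integrable_const _) ?_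
  · exact Eventually.of_forall fun y => (Measurable.ite measurableSet_Iic measurable_const
      measurable_const).aestronglyMeasurable
  · refine Eventually.of_forall fun y => Eventually.of_forall fun z => ?_
    split_ifs <;> simp
  · have : ∀ᵐ z ∂gaussianReal 0 1, z ≠ x := by
      rw [ae_iff]; simp
    filter_upwards [this] with z hz
    rcases lt_or_gt_of_ne hz with h | h
    · refine (continuousAt_const (y := (1 : ℝ))).congr ?_
      filter_upwards [lt_mem_nhds h] with y hy
      rw [if_pos hy.le]
    · refine (continuousAt_const (y := (0 : ℝ))).congr ?_
      filter_upwards [gt_mem_nhds h] with y hy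
      rw [if_neg (not_le.2 hy)]

lemma gM_map_one {r : ℕ} (a : Fin r × Fin r) : (gM r).map (fun z => z a) = gaussianReal 0 1 :=
  (measurePreserving_eval (fun _ : Fin r × Fin r => gaussianReal 0 1) a).map_eq

lemma gM_indep (r : ℕ) : iIndepFun (fun (a : Fin r × Fin r) (z : Fin r × Fin r → ℝ) => z a)
    (gM r) := by
  unfold gM
  exact iIndepFun_pi (X := fun _ x => x) (fun _ => aemeasurable_id)

lemma gM_map_two {r : ℕ} {a b : Fin r × Fin r} (h : a ≠ b) :
    (gM r).map (fun z => (z a, z b)) = (gaussianReal 0 1).prod (gaussianReal 0 1) := by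
  have := (indepFun_iff_map_prod_eq_prod_map_map (measurable_pi_apply a).aemeasurable
    (measurable_pi_apply b).aemeasurable).1 ((gM_indep r).indepFun h)
  rw [this, gM_map_one, gM_map_one]

lemma gM_map_three {r : ℕ} {a b c : Fin r × Fin r} (hab : a ≠ b) (hac : a ≠ c) (hbc : b ≠ c) :
    (gM r).map (fun z => ((z b, z c), z a)) =
      ((gaussianReal 0 1).prod (gaussianReal 0 1)).prod (gaussianReal 0 1) := by
  have := (indepFun_iff_map_prod_eq_prod_map_map 
    ((measurable_pi_apply b).prodMk (measurable_pi_apply c)).aemeasurable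
    (measurable_pi_apply a).aemeasurable).1
    ((gM_indep r).indepFun_prodMk (fun _ => measurable_pi_apply _) b c a hab.symm hac.symm)
  rw [this, gM_map_one, gM_map_two hbc]

/-- shorthand for the distinguished scores -/
abbrev E3 := EuclideanSpace ℝ (Fin 3 × Fin 3)

/-- the centred comparison product -/
def gfun (α : ℝ) (s : E3) : ℝ :=
  ((if s (1, 0) ≤ s (0, 0) then (1 : ℝ) else 0) - Phi (s (0, 0) / Real.sqrt α)) *
  ((if s (2, 0) ≤ s (0, 0) then (1 : ℝ) else 0) - Phi (s (0, 0) / Real.sqrt α))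

lemma meas_ite_le {X : Type*} [MeasurableSpace X] {f g : X → ℝ} (hf : Measurable f)
    (hg : Measurable g) : Measurable (fun x => if f x ≤ g x then (1 : ℝ) else 0) :=
  Measurable.ite (measurableSet_le hf hg) measurable_const measurable_const

lemma gfun_meas (α : ℝ) : Measurable (gfun α) := by
  unfold gfun
  have h : ∀ i, Measurable (fun s : E3 => s i) := fun i => by fun_prop
  have hP : Measurable (fun s : E3 => Phi (s (0, 0) / Real.sqrt α)) :=
    Phi_continuous.measurable.comp ((h _).div_const _)
  exact ((meas_ite_le (h _) (h _)).sub hP).mul ((meas_ite_le (h _) (h _)).sub hP)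

lemma abs_ind_sub_Phi_le (P : Prop) [Decidable P] (x : ℝ) :
    |(if P then (1 : ℝ) else 0) - Phi x| ≤ 1 := by
  have := Phi_nonneg x
  have := Phi_le_one x
  rw [abs_le]; split_ifs <;> constructor <;> linarith

lemma gfun_lim {α : ℝ} (hα : 0 < α) : ∫ s, gfun α s ∂(QLim 3 α : Measure E3) = 0 := by
  change ∫ s, gfun α s ∂((gM 3).map (limMap α)) = 0
  have hs : 0 < Real.sqrt α := Real.sqrt_pos.2 hα
  rw [integral_map (limMap_meas α).aemeasurable (gfun_meas α).aestronglyMeasurable]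
  let G : (ℝ × ℝ) × ℝ → ℝ := fun p =>
    ((if Real.sqrt α * p.1.2 ≤ 1 + Real.sqrt α * p.1.1 then (1 : ℝ) else 0)
      - Phi ((1 + Real.sqrt α * p.1.1) / Real.sqrt α)) *
    ((if Real.sqrt α * p.2 ≤ 1 + Real.sqrt α * p.1.1 then (1 : ℝ) else 0)
      - Phi ((1 + Real.sqrt α * p.1.1) / Real.sqrt α))
  have hP : Measurable (fun p : (ℝ × ℝ) × ℝ => Phi ((1 + Real.sqrt α * p.1.1) / Real.sqrt α)) :=
    Phi_continuous.measurable.comp (by fun_prop)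
  have hG : Measurable G :=
    ((meas_ite_le (by fun_prop) (by fun_prop)).sub hP).mul
      ((meas_ite_le (by fun_prop) (by fun_prop)).sub hP)
  have h1 : ∀ z : Fin 3 × Fin 3 → ℝ, gfun α (limMap α z) = G ((z (0, 0), z (1, 0)), z (2, 0)) := by
    intro z
    simp [gfun, limMap, dl, G]
  simp_rw [h1]
  rw [← integral_map (μ := gM 3) (φ := fun z => ((z (0, 0), z (1, 0)), z (2, 0))) (f := G)
    (by fun_prop) hG.aestronglyMeasurable, gM_map_three (by decide) (by decide) (by decide)]
  rw [integral_prod]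
  · have : ∀ x : ℝ × ℝ, ∫ y, G (x, y) ∂gaussianReal 0 1 = 0 := by
      intro x
      change ∫ y, ((if Real.sqrt α * x.2 ≤ 1 + Real.sqrt α * x.1 then (1 : ℝ) else 0)
        - Phi ((1 + Real.sqrt α * x.1) / Real.sqrt α)) *
        ((if Real.sqrt α * y ≤ 1 + Real.sqrt α * x.1 then (1 : ℝ) else 0)
        - Phi ((1 + Real.sqrt α * x.1) / Real.sqrt α)) ∂gaussianReal 0 1 = 0
      refine (integral_const_mul (L := ℝ) _ _).trans ?_
      rw [integral_sub, Phi_eq_integral]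
      · simp only [integral_const, probReal_univ, one_smul]
        have : ∀ y : ℝ, (Real.sqrt α * y ≤ 1 + Real.sqrt α * x.1) ↔
            y ≤ (1 + Real.sqrt α * x.1) / Real.sqrt α := fun y => by
          rw [le_div_iff₀ hs, mul_comm]
        simp_rw [this, sub_self, mul_zero]
      · refine Integrable.of_bound (meas_ite_le (by fun_prop) (by fun_prop)).aestronglyMeasurable 1
          (Eventually.of_forall fun y => ?_)
        split_ifs <;> simp
      · exact integrable_const _
    simp [this]
  · refine Integrable.of_bound hG.aestronglyMeasurable 1 (Eventually.of_forall fun p => ?_)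
    rw [Real.norm_eq_abs, abs_mul]
    exact mul_le_one₀ (abs_ind_sub_Phi_le _ _) (abs_nonneg _) (abs_ind_sub_Phi_le _ _)

/-- ties have probability zero in the limit -/
lemma QLim_no_ties {α : ℝ} (hα : 0 < α) {j : Fin 3} (hj : j ≠ 0) :
    ∀ᵐ s ∂(QLim 3 α : Measure E3), s (0, 0) - s (j, 0) ≠ 0 := by
  change ∀ᵐ s ∂((gM 3).map (limMap α)), s (0, 0) - s (j, 0) ≠ 0
  have hs : 0 < Real.sqrt α := Real.sqrt_pos.2 hα
  have hms : MeasurableSet {s : E3 | s (0, 0) - s (j, 0) ≠ 0} :=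
    (measurableSet_eq_fun (by fun_prop) measurable_const).compl
  rw [ae_map_iff (limMap_meas α).aemeasurable hms]
  have hj' : ((0, 0) : Fin 3 × Fin 3) ≠ (j, 0) := fun h => hj (Prod.ext_iff.1 h).1.symm
  have : NullSingletonClass (gaussianReal 0 1) := nullSingletonClass_gaussianReal one_ne_zero
  have h2 : ∀ᵐ p ∂(gaussianReal 0 1).prod (gaussianReal 0 1),
      1 + Real.sqrt α * p.1 - Real.sqrt α * p.2 ≠ 0 := by
    have hm2 : MeasurableSet {p : ℝ × ℝ | 1 + Real.sqrt α * p.1 - Real.sqrt α * p.2 ≠ 0} :=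
      (measurableSet_eq_fun (by fun_prop) measurable_const).compl
    rw [Measure.ae_prod_iff_ae_ae hm2]
    refine Eventually.of_forall fun x => ?_
    have : ∀ᵐ z ∂gaussianReal 0 1, z ≠ (1 + Real.sqrt α * x) / Real.sqrt α := by
      rw [ae_iff]; simp
    filter_upwards [this] with z hz h
    apply hz
    rw [eq_div_iff hs.ne']; linarith
  rw [← gM_map_two hj'] at h2
  have h3 := ae_of_ae_map (by fun_prop) h2
  filter_upwards [h3] with z hz
  simpa [limMap, dl, hj] using hz
/-! ### Part 8: passing to the limit in the comparison product -/

lemma tendsto_integral_of_bdd {X : Type*} [MeasurableSpace X] [TopologicalSpace X]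
    [OpensMeasurableSpace X] {Q : ℕ → ProbabilityMeasure X} {Q0 : ProbabilityMeasure X}
    (hQ : Tendsto Q atTop (𝓝 Q0)) (F : X → ℝ) (hF : Continuous F) (C : ℝ) (hC : ∀ x, |F x| ≤ C) :
    Tendsto (fun m => ∫ x, F x ∂(Q m : Measure X)) atTop (𝓝 (∫ x, F x ∂(Q0 : Measure X))) :=
  (ProbabilityMeasure.tendsto_iff_forall_integral_tendsto.1 hQ)
    (BoundedContinuousFunction.ofNormedAddCommGroup F hF C hC)

/-- smoothed step -/
def stp (K x : ℝ) : ℝ := max 0 (min 1 (1 + K * x))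

/-- bump at the origin -/
def bmp (K x : ℝ) : ℝ := max 0 (1 - K * |x|)

lemma stp_cont (K : ℝ) : Continuous (stp K) := by unfold stp; fun_prop

lemma bmp_cont (K : ℝ) : Continuous (bmp K) := by unfold bmp; fun_prop

lemma stp_nonneg (K x : ℝ) : 0 ≤ stp K x := le_max_left _ _

lemma stp_le_one (K x : ℝ) : stp K x ≤ 1 := max_le zero_le_one (min_le_left _ _)

lemma bmp_nonneg (K x : ℝ) : 0 ≤ bmp K x := le_max_left _ _

lemma bmp_le_one {K : ℝ} (hK : 0 ≤ K) (x : ℝ) : bmp K x ≤ 1 :=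
  max_le zero_le_one (by have := mul_nonneg hK (abs_nonneg x); linarith)

lemma ind_sub_stp {K : ℝ} (hK : 0 ≤ K) (a b : ℝ) :
    |(if a ≤ b then (1 : ℝ) else 0) - stp K (b - a)| ≤ bmp K (b - a) := by
  unfold stp bmp
  split_ifs with h
  · have : 0 ≤ K * (b - a) := mul_nonneg hK (by linarith)
    rw [min_eq_left (by linarith), max_eq_right zero_le_one]
    simp
  · have : K * (b - a) ≤ 0 := mul_nonpos_of_nonneg_of_nonpos hK (by linarith)
    rw [min_eq_right (by linarith), abs_of_neg (by linarith : b - a < 0), zero_sub, abs_neg,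
      abs_of_nonneg (le_max_left _ _)]
    apply le_of_eq; congr 1; ring

lemma bmp_integral_tendsto (Q0 : ProbabilityMeasure E3) (j : Fin 3)
    (h : ∀ᵐ s ∂(Q0 : Measure E3), s (0, 0) - s (j, 0) ≠ 0) :
    Tendsto (fun k : ℕ => ∫ s : E3, bmp k (s (0, 0) - s (j, 0)) ∂(Q0 : Measure E3)) atTop (𝓝 0) := by
  have h0 : ∫ _ : E3, (0 : ℝ) ∂(Q0 : Measure E3) = 0 := by simp
  rw [← h0]
  refine tendsto_integral_of_dominated_convergence (fun _ => 1) ?_ (integrable_const _) ?_ ?_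
  · intro k
    exact ((bmp_cont k).comp (by fun_prop)).aestronglyMeasurable
  · intro k
    refine Eventually.of_forall fun s => ?_
    rw [Real.norm_eq_abs, abs_of_nonneg (bmp_nonneg _ _)]
    exact bmp_le_one (Nat.cast_nonneg k) _
  · filter_upwards [h] with s hs
    have hpos := abs_pos.2 hs
    obtain ⟨K, hK⟩ := exists_nat_gt (1 / |s (0, 0) - s (j, 0)|)
    refine tendsto_const_nhds.congr' ?_
    filter_upwards [eventually_ge_atTop K] with k hk
    have : (K : ℝ) ≤ k := by exact_mod_cast hk
    rw [div_lt_iff₀ hpos] at hK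
    have := mul_le_mul_of_nonneg_right this hpos.le
    rw [bmp, max_eq_left (by linarith)]

/-- smoothed version of the comparison product -/
def gsm (K α : ℝ) (s : E3) : ℝ :=
  (stp K (s (0, 0) - s (1, 0)) - Phi (s (0, 0) / Real.sqrt α)) *
  (stp K (s (0, 0) - s (2, 0)) - Phi (s (0, 0) / Real.sqrt α))

lemma gsm_cont (K α : ℝ) : Continuous (gsm K α) := by
  have h := stp_cont K
  have h' := Phi_continuous
  unfold gsm
  fun_prop

lemma abs_sub_unit {a b : ℝ} (ha : 0 ≤ a) (ha1 : a ≤ 1) (hb : 0 ≤ b) (hb1 : b ≤ 1) :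
    |a - b| ≤ 1 := by
  rw [abs_le]; constructor <;> linarith

lemma gsm_bdd (K α : ℝ) (s : E3) : |gsm K α s| ≤ 1 := by
  rw [gsm, abs_mul]
  exact mul_le_one₀ (abs_sub_unit (stp_nonneg _ _) (stp_le_one _ _) (Phi_nonneg _) (Phi_le_one _))
    (abs_nonneg _)
    (abs_sub_unit (stp_nonneg _ _) (stp_le_one _ _) (Phi_nonneg _) (Phi_le_one _))

lemma gfun_bdd (α : ℝ) (s : E3) : |gfun α s| ≤ 1 := by
  rw [gfun, abs_mul]
  exact mul_le_one₀ (abs_ind_sub_Phi_le _ _) (abs_nonneg _) (abs_ind_sub_Phi_le _ _)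

lemma gfun_sub_gsm {K : ℝ} (hK : 0 ≤ K) (α : ℝ) (s : E3) :
    |gfun α s - gsm K α s| ≤ bmp K (s (0, 0) - s (1, 0)) + bmp K (s (0, 0) - s (2, 0)) := by
  unfold gfun gsm
  set φ := Phi (s (0, 0) / Real.sqrt α)
  set a := (if s (1, 0) ≤ s (0, 0) then (1 : ℝ) else 0) with ha
  set b := (if s (2, 0) ≤ s (0, 0) then (1 : ℝ) else 0) with hb
  set a' := stp K (s (0, 0) - s (1, 0))
  set b' := stp K (s (0, 0) - s (2, 0))
  have h1 : |a - a'| ≤ _ := ind_sub_stp hK _ _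
  have h2 : |b - b'| ≤ _ := ind_sub_stp hK _ _
  have h3 : |b - φ| ≤ 1 := abs_ind_sub_Phi_le _ _
  have h4 : |a' - φ| ≤ 1 :=
    abs_sub_unit (stp_nonneg _ _) (stp_le_one _ _) (Phi_nonneg _) (Phi_le_one _)
  have : (a - φ) * (b - φ) - (a' - φ) * (b' - φ) = (a - a') * (b - φ) + (a' - φ) * (b - b') := by
    ring
  rw [this]
  refine (abs_add_le _ _).trans (add_le_add ?_ ?_)
  · rw [abs_mul]
    exact (mul_le_of_le_one_right (abs_nonneg _) h3).trans h1
  · rw [abs_mul]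
    exact (mul_le_of_le_one_left (abs_nonneg _) h4).trans h2

lemma gfun_tendsto {Q : ℕ → ProbabilityMeasure E3} {Q0 : ProbabilityMeasure E3}
    (hQ : Tendsto Q atTop (𝓝 Q0)) (α : ℝ)
    (h1 : ∀ᵐ s ∂(Q0 : Measure E3), s (0, 0) - s (1, 0) ≠ 0)
    (h2 : ∀ᵐ s ∂(Q0 : Measure E3), s (0, 0) - s (2, 0) ≠ 0) :
    Tendsto (fun m => ∫ s, gfun α s ∂(Q m : Measure E3)) atTop
      (𝓝 (∫ s, gfun α s ∂(Q0 : Measure E3))) := by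
  let B : ℝ → E3 → ℝ := fun K s => bmp K (s (0, 0) - s (1, 0)) + bmp K (s (0, 0) - s (2, 0))
  have hBc : ∀ K, Continuous (B K) := fun K => by
    have := bmp_cont K
    simp only [B]; fun_prop
  have hBb : ∀ K, 0 ≤ K → ∀ s, |B K s| ≤ 2 := fun K hK s => by
    rw [abs_of_nonneg (add_nonneg (bmp_nonneg _ _) (bmp_nonneg _ _))]
    have h1 := bmp_le_one hK (s (0, 0) - s (1, 0))
    have h2 := bmp_le_one hK (s (0, 0) - s (2, 0))
    linarith
  have hBi : ∀ K, 0 ≤ K → ∀ R : ProbabilityMeasure E3, Integrable (B K) (R : Measure E3) :=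
    fun K hK R => Integrable.of_bound (hBc K).aestronglyMeasurable 2
      (Eventually.of_forall (hBb K hK))
  have hB0 : Tendsto (fun k : ℕ => ∫ s, B k s ∂(Q0 : Measure E3)) atTop (𝓝 0) := by
    have := (bmp_integral_tendsto Q0 1 h1).add (bmp_integral_tendsto Q0 2 h2)
    rw [add_zero] at this
    refine this.congr fun k => ?_
    have hb := bmp_cont (k : ℝ)
    refine (integral_add ?_ ?_).symm <;>
    · refine Integrable.of_bound (Continuous.aestronglyMeasurable (by fun_prop)) 1
        (Eventually.of_forall fun s => ?_)
      rw [Real.norm_eq_abs, abs_of_nonneg (bmp_nonneg _ _)]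
      exact bmp_le_one (Nat.cast_nonneg k) _
  have hdiff : ∀ k : ℕ, ∀ R : ProbabilityMeasure E3,
      |∫ s, gfun α s ∂(R : Measure E3) - ∫ s, gsm k α s ∂(R : Measure E3)| ≤
        ∫ s, B k s ∂(R : Measure E3) := by
    intro k R
    rw [← integral_sub]
    · refine (abs_integral_le_integral_abs).trans ?_
      refine integral_mono_of_nonneg (Eventually.of_forall fun s => abs_nonneg _)
        (hBi k (Nat.cast_nonneg k) R) (Eventually.of_forall fun s => ?_)
      exact gfun_sub_gsm (Nat.cast_nonneg k) α s
    · exact Integrable.of_bound (gfun_meas α).aestronglyMeasurable 1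
        (Eventually.of_forall (gfun_bdd α))
    · exact Integrable.of_bound (gsm_cont k α).aestronglyMeasurable 1
        (Eventually.of_forall (gsm_bdd k α))
  rw [Metric.tendsto_atTop']
  intro ε hε
  obtain ⟨k, hk⟩ := ((tendsto_order.1 hB0).2 (ε / 4) (by linarith)).exists
  have e1 := (tendsto_order.1 (tendsto_integral_of_bdd hQ (B k) (hBc k) 2
    (hBb k (Nat.cast_nonneg k)))).2 (ε / 4) hk
  have e2 := (Metric.tendsto_nhds.1 (tendsto_integral_of_bdd hQ (gsm k α) (gsm_cont k α) 1
    (gsm_bdd k α))) (ε / 4) (by linarith)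
  obtain ⟨M, hM⟩ := eventually_atTop.1 (e1.and e2)
  refine ⟨M, fun m hm => ?_⟩
  obtain ⟨a1, a2⟩ := hM m hm.le
  have a3 := hdiff k (Q m)
  have a4 := hdiff k Q0
  rw [Real.dist_eq, abs_lt] at *
  rw [abs_le] at a3 a4
  constructor <;> linarith [a2.1, a2.2, a3.1, a3.2, a4.1, a4.2]
/-! ### Part 9: conditional law of large numbers for the percentile -/

/-- centred comparison indicator -/
def Dj {d n : ℕ} (α : ℝ) (i j : Fin n) (p : (Fin n → Fin d → ℝ) × (Fin n → Fin d → ℝ)) : ℝ :=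
  (if scoreX p.1 p.2 j i ≤ scoreX p.1 p.2 i i then (1 : ℝ) else 0) -
    Phi (scoreX p.1 p.2 i i / Real.sqrt α)

lemma Dj_meas {d n : ℕ} (α : ℝ) (i j : Fin n) : Measurable (Dj (d := d) α i j) :=
  (meas_ite_le (scoreX_meas _ _) (scoreX_meas _ _)).sub
    (Phi_continuous.measurable.comp ((scoreX_meas _ _).div_const _))

lemma Dj_mul_bdd {d n : ℕ} (α : ℝ) (i j k : Fin n)
    (p : (Fin n → Fin d → ℝ) × (Fin n → Fin d → ℝ)) : |Dj α i j p * Dj α i k p| ≤ 1 := by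
  rw [abs_mul]
  exact mul_le_one₀ (abs_ind_sub_Phi_le _ _) (abs_nonneg _) (abs_ind_sub_Phi_le _ _)

lemma Dj_mul_int {d n : ℕ} (α : ℝ) (i j k : Fin n) :
    Integrable (fun p => Dj (d := d) α i j p * Dj α i k p) (gaussianModel d n) :=
  Integrable.of_bound ((Dj_meas α i j).mul (Dj_meas α i k)).aestronglyMeasurable 1
    (Eventually.of_forall (Dj_mul_bdd α i j k))

lemma Dj_offdiag {d n : ℕ} (α : ℝ) {i j k : Fin n} (hj : j ≠ i) (hk : k ≠ i) (hjk : j ≠ k) :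
    ∫ p, Dj (d := d) α i j p * Dj α i k p ∂gaussianModel d n =
      ∫ s, gfun α s ∂(QE 3 d (n - 3) : Measure E3) := by
  have he : Function.Injective ![i, j, k] := by
    intro a b hab
    fin_cases a <;> fin_cases b <;> simp_all
  rw [← integral_scores ![i, j, k] he (gfun α) (gfun_meas α)]
  rfl

lemma percentile_sub {d n : ℕ} (hn : 2 ≤ n) (α : ℝ) (i : Fin n)
    (p : (Fin n → Fin d → ℝ) × (Fin n → Fin d → ℝ)) :
    percentile p i - Phi (scoreX p.1 p.2 i i / Real.sqrt α) =
      (∑ j ∈ Finset.univ.erase i, Dj α i j p) / ((n : ℝ) - 1) := by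
  have h2 : (2 : ℝ) ≤ n := by exact_mod_cast hn
  have h1 : ((n : ℝ) - 1) ≠ 0 := by linarith
  simp only [Dj, percentile, Finset.sum_sub_distrib, Finset.sum_const,
    Finset.card_erase_of_mem (Finset.mem_univ i), Finset.card_univ, Fintype.card_fin, nsmul_eq_mul]
  rw [Nat.cast_sub (by omega)]
  field_simp
  simp [mul_comm]

lemma percentile_var {d n : ℕ} (hn : 2 ≤ n) (α : ℝ) (i : Fin n) :
    ∫ p, (percentile p i - Phi (scoreX p.1 p.2 i i / Real.sqrt α)) ^ 2 ∂gaussianModel d n ≤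
      1 / ((n : ℝ) - 1) + |∫ s, gfun α s ∂(QE 3 d (n - 3) : Measure E3)| := by
  set c := ∫ s, gfun α s ∂(QE 3 d (n - 3) : Measure E3)
  have h2 : (2 : ℝ) ≤ n := by exact_mod_cast hn
  have h1 : 0 < ((n : ℝ) - 1) := by linarith
  have hcard : ((Finset.univ.erase i).card : ℝ) = (n : ℝ) - 1 := by
    rw [Finset.card_erase_of_mem (Finset.mem_univ i), Finset.card_univ, Fintype.card_fin,
      Nat.cast_sub (by omega)]
    simp
  have e : ∀ p : (Fin n → Fin d → ℝ) × (Fin n → Fin d → ℝ),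
      (percentile p i - Phi (scoreX p.1 p.2 i i / Real.sqrt α)) ^ 2 =
      (∑ j ∈ Finset.univ.erase i, ∑ k ∈ Finset.univ.erase i, Dj α i j p * Dj α i k p) /
        ((n : ℝ) - 1) ^ 2 := by
    intro p
    rw [percentile_sub hn, div_pow, sq (∑ j ∈ _, _), Finset.sum_mul_sum]
  simp_rw [e]
  rw [integral_div, integral_finsetSum _ fun j _ => integrable_finsetSum _ fun k _ =>
    Dj_mul_int α i j k]
  simp_rw [integral_finsetSum _ fun k _ => Dj_mul_int α i _ k]
  have hb : ∀ j ∈ Finset.univ.erase i, ∀ k ∈ Finset.univ.erase i,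
      ∫ p, Dj (d := d) α i j p * Dj α i k p ∂gaussianModel d n ≤ (if j = k then 1 else 0) + |c| := by
    intro j hj k hk
    by_cases h : j = k
    · rw [if_pos h]
      have : ∫ p, Dj (d := d) α i j p * Dj α i k p ∂gaussianModel d n ≤
          ∫ _, (1 : ℝ) ∂gaussianModel d n :=
        integral_mono (Dj_mul_int α i j k) (integrable_const _)
          fun p => (le_abs_self _).trans (Dj_mul_bdd α i j k p)
      simp only [integral_const, probReal_univ, one_smul] at this
      linarith [abs_nonneg c]
    · rw [if_neg h, Dj_offdiag α (Finset.ne_of_mem_erase hj) (Finset.ne_of_mem_erase hk) h,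
        zero_add]
      exact le_abs_self _
  have hsum : ∑ j ∈ Finset.univ.erase i, ∑ k ∈ Finset.univ.erase i,
      ∫ p, Dj (d := d) α i j p * Dj α i k p ∂gaussianModel d n ≤
      ((n : ℝ) - 1) + ((n : ℝ) - 1) ^ 2 * |c| := by
    refine (Finset.sum_le_sum fun j hj => Finset.sum_le_sum fun k hk => hb j hj k hk).trans ?_
    simp only [Finset.sum_add_distrib, Finset.sum_const, nsmul_eq_mul, hcard]
    have : ∑ j ∈ Finset.univ.erase i, ∑ k ∈ Finset.univ.erase i, (if j = k then (1 : ℝ) else 0)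
        = (n : ℝ) - 1 := by
      rw [← hcard, ← mul_one ((Finset.univ.erase i).card : ℝ), ← nsmul_eq_mul, ← Finset.sum_const]
      refine Finset.sum_congr rfl fun j hj => ?_
      rw [Finset.sum_ite_eq, if_pos hj]
    rw [this]
    apply le_of_eq; ring
  rw [div_le_iff₀ (by positivity)]
  refine hsum.trans (le_of_eq ?_)
  field_simp

lemma percentile_mem {d n : ℕ} (hn : 2 ≤ n) (i : Fin n)
    (p : (Fin n → Fin d → ℝ) × (Fin n → Fin d → ℝ)) : percentile p i ∈ Set.Icc (0 : ℝ) 1 := by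
  have h2 : (2 : ℝ) ≤ n := by exact_mod_cast hn
  have h1 : 0 < ((n : ℝ) - 1) := by linarith
  have hcard : ((Finset.univ.erase i).card : ℝ) = (n : ℝ) - 1 := by
    rw [Finset.card_erase_of_mem (Finset.mem_univ i), Finset.card_univ, Fintype.card_fin,
      Nat.cast_sub (by omega)]
    simp
  unfold percentile
  constructor
  · exact div_nonneg (Finset.sum_nonneg fun j _ => by split_ifs <;> norm_num) h1.le
  · rw [div_le_one h1, ← hcard, ← mul_one ((Finset.univ.erase i).card : ℝ), ← nsmul_eq_mul,
      ← Finset.sum_const]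
    exact Finset.sum_le_sum fun j _ => by split_ifs <;> norm_num

lemma percentile_meas {d n : ℕ} (i : Fin n) : Measurable
    (fun p : (Fin n → Fin d → ℝ) × (Fin n → Fin d → ℝ) => percentile p i) := by
  unfold percentile
  exact (Finset.measurable_fun_sum _ fun j _ =>
    meas_ite_le (scoreX_meas _ _) (scoreX_meas _ _)).div_const _
/-! ### Part 10: conclusion -/

lemma unif_bound (f : BoundedContinuousFunction (ℝ × ℝ) ℝ) {ε : ℝ} (hε : 0 < ε) :
    ∃ C : ℝ, 0 ≤ C ∧ ∀ x1 ∈ Set.Icc (0 : ℝ) 1, ∀ x2 ∈ Set.Icc (0 : ℝ) 1,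
      ∀ y1 ∈ Set.Icc (0 : ℝ) 1, ∀ y2 ∈ Set.Icc (0 : ℝ) 1,
      |f (x1, x2) - f (y1, y2)| ≤ ε + C * ((x1 - y1) ^ 2 + (x2 - y2) ^ 2) := by
  have hK : IsCompact (Set.Icc (0 : ℝ) 1 ×ˢ Set.Icc (0 : ℝ) 1) := isCompact_Icc.prod isCompact_Icc
  have hu := hK.uniformContinuousOn_of_continuous f.continuous.continuousOn
  rw [Metric.uniformContinuousOn_iff] at hu
  obtain ⟨δ, hδ, h⟩ := hu ε hε
  have hC : 0 ≤ 2 * ‖f‖ / δ ^ 2 := by positivity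
  refine ⟨2 * ‖f‖ / δ ^ 2, hC, fun x1 hx1 x2 hx2 y1 hy1 y2 hy2 => ?_⟩
  by_cases hd : dist (x1, x2) (y1, y2) < δ
  · have := h (x1, x2) ⟨hx1, hx2⟩ (y1, y2) ⟨hy1, hy2⟩ hd
    rw [Real.dist_eq] at this
    have : 0 ≤ 2 * ‖f‖ / δ ^ 2 * ((x1 - y1) ^ 2 + (x2 - y2) ^ 2) := by positivity
    linarith
  · have h1 : |f (x1, x2) - f (y1, y2)| ≤ 2 * ‖f‖ := by
      have a := f.norm_coe_le_norm (x1, x2)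
      have b := f.norm_coe_le_norm (y1, y2)
      have c := norm_sub_le (f (x1, x2)) (f (y1, y2))
      rw [Real.norm_eq_abs] at c
      linarith
    have h2 : δ ^ 2 ≤ (x1 - y1) ^ 2 + (x2 - y2) ^ 2 := by
      rw [not_lt, Prod.dist_eq, le_max_iff] at hd
      rw [Real.dist_eq, Real.dist_eq] at hd
      rcases hd with hd | hd
      · have := pow_le_pow_left₀ hδ.le hd 2
        rw [sq_abs] at this
        simp only at this
        nlinarith [sq_nonneg (x2 - y2)]
      · have := pow_le_pow_left₀ hδ.le hd 2
        rw [sq_abs] at this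
        simp only at this
        nlinarith [sq_nonneg (x1 - y1)]
    have h3 := mul_le_mul_of_nonneg_left h2 hC
    rw [div_mul_cancel₀ _ (by positivity)] at h3
    linarith

/-- limit functional -/
def Ffun (α : ℝ) (f : BoundedContinuousFunction (ℝ × ℝ) ℝ) (s : E3) : ℝ :=
  f (Phi (s (0, 0) / Real.sqrt α), Phi (s (1, 1) / Real.sqrt α))

lemma Ffun_cont (α : ℝ) (f : BoundedContinuousFunction (ℝ × ℝ) ℝ) : Continuous (Ffun α f) := by
  have h := Phi_continuous
  have h' := f.continuous
  unfold Ffun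
  fun_prop

lemma Ffun_lim {α : ℝ} (hα : 0 < α) (f : BoundedContinuousFunction (ℝ × ℝ) ℝ) :
    ∫ s, Ffun α f s ∂(QLim 3 α : Measure E3) =
    ∫ z : ℝ × ℝ, f (Phi (1 / Real.sqrt α + z.1), Phi (1 / Real.sqrt α + z.2))
          ∂((gaussianReal 0 1).prod (gaussianReal 0 1)) := by
  change ∫ s, Ffun α f s ∂((gM 3).map (limMap α)) = _
  have hs : Real.sqrt α ≠ 0 := (Real.sqrt_pos.2 hα).ne'
  have h := Phi_continuous
  have h' := f.continuous
  have hc : Continuous fun z : ℝ × ℝ =>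
      f (Phi (1 / Real.sqrt α + z.1), Phi (1 / Real.sqrt α + z.2)) := by fun_prop
  rw [integral_map (limMap_meas α).aemeasurable (Ffun_cont α f).aestronglyMeasurable,
    ← gM_map_two (r := 3) (a := (0, 0)) (b := (1, 1)) (by decide),
    integral_map (by fun_prop) hc.aestronglyMeasurable]
  refine integral_congr_ae (Eventually.of_forall fun z => ?_)
  have : ∀ x : ℝ, (1 + Real.sqrt α * x) / Real.sqrt α = 1 / Real.sqrt α + x := fun x => by
    field_simp
  simp only [Ffun, limMap, dl, if_true, this]

lemma joint_approx {d n : ℕ} (hn : 2 ≤ n) (α : ℝ) (f : BoundedContinuousFunction (ℝ × ℝ) ℝ)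
    {ε C : ℝ} (hC : 0 ≤ C) (hf : ∀ x1 ∈ Set.Icc (0 : ℝ) 1, ∀ x2 ∈ Set.Icc (0 : ℝ) 1,
      ∀ y1 ∈ Set.Icc (0 : ℝ) 1, ∀ y2 ∈ Set.Icc (0 : ℝ) 1,
      |f (x1, x2) - f (y1, y2)| ≤ ε + C * ((x1 - y1) ^ 2 + (x2 - y2) ^ 2)) (i j : Fin n) :
    |∫ p, f (percentile p i, percentile p j) ∂gaussianModel d n -
      ∫ p, f (Phi (scoreX p.1 p.2 i i / Real.sqrt α), Phi (scoreX p.1 p.2 j j / Real.sqrt α))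
        ∂gaussianModel d n| ≤
      ε + C * (2 * (1 / ((n : ℝ) - 1) + |∫ s, gfun α s ∂(QE 3 d (n - 3) : Measure E3)|)) := by
  have hPm : ∀ i : Fin n, Measurable fun p : (Fin n → Fin d → ℝ) × (Fin n → Fin d → ℝ) =>
      Phi (scoreX p.1 p.2 i i / Real.sqrt α) := fun i =>
    Phi_continuous.measurable.comp ((scoreX_meas _ _).div_const _)
  have hPI : ∀ x, Phi x ∈ Set.Icc (0 : ℝ) 1 := fun x => ⟨Phi_nonneg x, Phi_le_one x⟩
  have hsq : ∀ i : Fin n, Integrable (fun p =>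
      (percentile p i - Phi (scoreX p.1 p.2 i i / Real.sqrt α)) ^ 2) (gaussianModel d n) := by
    intro i
    refine Integrable.of_bound (((percentile_meas i).sub (hPm i)).pow_const 2).aestronglyMeasurable
      1 (Eventually.of_forall fun p => ?_)
    have a := percentile_mem hn i p
    have b := hPI (scoreX p.1 p.2 i i / Real.sqrt α)
    rw [norm_pow, Real.norm_eq_abs]
    exact pow_le_one₀ (abs_nonneg _) (abs_sub_unit a.1 a.2 b.1 b.2)
  have hfb : ∀ x, ‖f x‖ ≤ ‖f‖ := f.norm_coe_le_norm
  rw [← integral_sub]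
  · refine abs_integral_le_integral_abs.trans ?_
    have h1 : ∫ p, |f (percentile p i, percentile p j) -
        f (Phi (scoreX p.1 p.2 i i / Real.sqrt α), Phi (scoreX p.1 p.2 j j / Real.sqrt α))|
        ∂gaussianModel d n ≤ ∫ p, (ε + C * ((percentile p i
          - Phi (scoreX p.1 p.2 i i / Real.sqrt α)) ^ 2 +
          (percentile p j - Phi (scoreX p.1 p.2 j j / Real.sqrt α)) ^ 2)) ∂gaussianModel d n := by
      refine integral_mono_of_nonneg (Eventually.of_forall fun s => abs_nonneg _)
        ((integrable_const _).add (((hsq i).add (hsq j)).const_mul C))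
        (Eventually.of_forall fun p => ?_)
      exact hf _ (percentile_mem hn i p) _ (percentile_mem hn j p) _ (hPI _) _ (hPI _)
    refine h1.trans ?_
    have hint : Integrable (fun p => C * ((percentile p i
          - Phi (scoreX p.1 p.2 i i / Real.sqrt α)) ^ 2 +
          (percentile p j - Phi (scoreX p.1 p.2 j j / Real.sqrt α)) ^ 2)) (gaussianModel d n) :=
      ((hsq i).add (hsq j)).const_mul C
    rw [integral_add (integrable_const _) hint,
      integral_const_mul, integral_add (hsq i) (hsq j)]
    simp only [integral_const, probReal_univ, one_smul]
    have a := percentile_var (d := d) hn α i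
    have b := percentile_var (d := d) hn α j
    gcongr
    linarith
  · exact Integrable.of_bound (f.continuous.measurable.comp
      ((percentile_meas i).prodMk (percentile_meas j))).aestronglyMeasurable ‖f‖
      (Eventually.of_forall fun p => hfb _)
  · exact Integrable.of_bound (f.continuous.measurable.comp
      ((hPm i).prodMk (hPm j))).aestronglyMeasurable ‖f‖
      (Eventually.of_forall fun p => hfb _)

/-- **Joint two-column percentile limit.** If `n, d → ∞` with `n/d² → α ∈ (0,∞)`, then
`(Ω_1^{(n)}, Ω_2^{(n)})` converges in distribution to a pair of independent copies of
`Ω = Φ(α^{-1/2} + Z)`, `Z` standard normal. Convergence in distribution is expressed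
through bounded continuous test functions. -/
theorem percentile_joint_two_column_limit (α : ℝ) (hα : 0 < α) (n d : ℕ → ℕ)
    (hn : Tendsto n atTop atTop) (hd : Tendsto d atTop atTop)
    (hlim : Tendsto (fun m => (n m : ℝ) / (d m : ℝ) ^ 2) atTop (𝓝 α)) :
    ∀ f : BoundedContinuousFunction (ℝ × ℝ) ℝ,
      Tendsto (fun m => ∫ p, f (if h : 2 ≤ n m then
            (percentile p (⟨0, by omega⟩ : Fin (n m)),
              percentile p (⟨1, by omega⟩ : Fin (n m))) else (0, 0))
          ∂gaussianModel (d m) (n m)) atTop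
        (𝓝 (∫ z : ℝ × ℝ, f (Phi (1 / Real.sqrt α + z.1), Phi (1 / Real.sqrt α + z.2))
          ∂((gaussianReal 0 1).prod (gaussianReal 0 1)))) := by
  intro f
  have hN : Tendsto (fun m => ((n m - 3 : ℕ) : ℝ) / (d m : ℝ) ^ 2) atTop (𝓝 α) := by
    have hd' : Tendsto (fun m => (d m : ℝ)) atTop atTop := tendsto_natCast_atTop_atTop.comp hd
    have h3 : Tendsto (fun m => (3 : ℝ) / (d m : ℝ) ^ 2) atTop (𝓝 0) :=
      ((tendsto_pow_atTop two_ne_zero).comp hd').const_div_atTop 3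
    have := hlim.sub h3
    rw [sub_zero] at this
    refine this.congr' ?_
    filter_upwards [hn.eventually_ge_atTop 3] with m hm
    rw [Nat.cast_sub hm, sub_div]; norm_num
  have hQ := QE_tendsto 3 hα d (fun m => n m - 3) hd hN
  have hc : Tendsto (fun m => ∫ s, gfun α s ∂(QE 3 (d m) (n m - 3) : Measure E3)) atTop (𝓝 0) := by
    have := gfun_tendsto hQ α (QLim_no_ties hα (by decide)) (QLim_no_ties hα (by decide))
    rwa [gfun_lim hα] at this
  have hF : Tendsto (fun m => ∫ s, Ffun α f s ∂(QE 3 (d m) (n m - 3) : Measure E3)) atTop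
      (𝓝 (∫ s, Ffun α f s ∂(QLim 3 α : Measure E3))) :=
    tendsto_integral_of_bdd hQ _ (Ffun_cont α f) ‖f‖ fun s => f.norm_coe_le_norm _
  rw [Ffun_lim hα] at hF
  have hb : Tendsto (fun m => 2 * (1 / ((n m : ℝ) - 1) +
      |∫ s, gfun α s ∂(QE 3 (d m) (n m - 3) : Measure E3)|)) atTop (𝓝 0) := by
    have hn' : Tendsto (fun m => (n m : ℝ) - 1) atTop atTop :=
      tendsto_atTop_add_const_right _ (-1) (tendsto_natCast_atTop_atTop.comp hn)
    have h1 : Tendsto (fun m => 1 / ((n m : ℝ) - 1)) atTop (𝓝 0) := hn'.const_div_atTop 1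
    simpa using (h1.add hc.abs).const_mul 2
  rw [Metric.tendsto_nhds]
  intro ε hε
  obtain ⟨C, hC, hfC⟩ := unif_bound f (by linarith : 0 < ε / 4)
  have hb' := hb.const_mul C
  rw [mul_zero] at hb'
  filter_upwards [hn.eventually_ge_atTop 3, (tendsto_order.1 hb').2 (ε / 4) (by linarith),
    (Metric.tendsto_nhds.1 hF) (ε / 4) (by linarith)] with m hm h1 h2
  have hm2 : 2 ≤ n m := by omega
  have hval : ∫ p, f (if h : 2 ≤ n m then
            (percentile p (⟨0, by omega⟩ : Fin (n m)),
              percentile p (⟨1, by omega⟩ : Fin (n m))) else (0, 0))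
          ∂gaussianModel (d m) (n m) =
      ∫ p, f (percentile p (⟨0, by omega⟩ : Fin (n m)),
              percentile p (⟨1, by omega⟩ : Fin (n m))) ∂gaussianModel (d m) (n m) := by
    simp only [dif_pos hm2]
  rw [hval]
  have h3 := joint_approx (d := d m) hm2 α f hC hfC (⟨0, by omega⟩ : Fin (n m))
    (⟨1, by omega⟩ : Fin (n m))
  have he : Function.Injective (![⟨0, by omega⟩, ⟨1, by omega⟩, ⟨2, by omega⟩] : Fin 3 → Fin (n m)) := by
    intro a b hab
    fin_cases a <;> fin_cases b <;> simp_all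
  have h4 : ∫ p, f (Phi (scoreX p.1 p.2 (⟨0, by omega⟩ : Fin (n m)) ⟨0, by omega⟩ / Real.sqrt α),
      Phi (scoreX p.1 p.2 (⟨1, by omega⟩ : Fin (n m)) ⟨1, by omega⟩ / Real.sqrt α))
        ∂gaussianModel (d m) (n m) =
      ∫ s, Ffun α f s ∂(QE 3 (d m) (n m - 3) : Measure E3) := by
    rw [← integral_scores _ he (Ffun α f) (Ffun_cont α f).measurable]
    rfl
  rw [h4] at h3
  rw [Real.dist_eq, abs_lt] at h2 ⊢
  rw [abs_le] at h3
  constructor <;> linarith [h2.1, h2.2, h3.1, h3.2]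

end
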